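/- arXiv:math/0601086 — 2 statements merged into one kernel-verified Lean document; each statement's English description precedes it below -/
import Mathlib

section
/- Suppose the cost function c satisfies conditions (A1), (A2) and that Ω* is c*-convex with respect to Ω. Let u ∈ C²(Ω̄) be an elliptic solution of the second boundary value problem det{D²u − c_{xx}(·, Y(·,Du))} = |det c_{x,y}(·, Y(·,Du))| ψ(·,u,Du) in Ω, Tu(Ω) = Ω*, such that the map Tu is one-to-one on Ω̄. Then u is globally c-convex in Ω: for every x₀ ∈ Ω, with y₀ = Tu(x₀), one has u(x) ≥ u(x₀) + c(x,y₀) − c(x₀,y₀) for all x ∈ Ω. -/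
noncomputable section

variable {n : ℕ}

/-- Partial derivative in the `i`-th coordinate direction. -/
def pd (i : Fin n) (f : (Fin n → ℝ) → ℝ) (x : Fin n → ℝ) : ℝ :=
  fderiv ℝ f x (Pi.single i 1)

/-- Gradient vector. -/
def gradv (f : (Fin n → ℝ) → ℝ) (x : Fin n → ℝ) : Fin n → ℝ :=
  fun i => pd i f x

/-- Hessian matrix `D²f`. -/
def hessM (f : (Fin n → ℝ) → ℝ) (x : Fin n → ℝ) : Matrix (Fin n) (Fin n) ℝ :=
  Matrix.of fun i j => pd i (fun z => pd j f z) x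

/-- `c_x(x,y)`. -/
def cxV (c : (Fin n → ℝ) → (Fin n → ℝ) → ℝ) (x y : Fin n → ℝ) : Fin n → ℝ :=
  gradv (fun z => c z y) x

/-- `c_y(x,y)`. -/
def cyV (c : (Fin n → ℝ) → (Fin n → ℝ) → ℝ) (x y : Fin n → ℝ) : Fin n → ℝ :=
  gradv (fun z => c x z) y

/-- `c_{xx}(x,y)`. -/
def cxxM (c : (Fin n → ℝ) → (Fin n → ℝ) → ℝ) (x y : Fin n → ℝ) :
    Matrix (Fin n) (Fin n) ℝ :=
  hessM (fun z => c z y) x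

/-- The matrix `c_{x,y} = [∂²c/∂x_i∂y_j]`. -/
def cxyM (c : (Fin n → ℝ) → (Fin n → ℝ) → ℝ) (x y : Fin n → ℝ) :
    Matrix (Fin n) (Fin n) ℝ :=
  Matrix.of fun i j => pd j (fun z => pd i (fun w => c w z) x) y

/-- Third derivatives `c_{ij,l} = ∂³c/∂x_i∂x_j∂y_l`. -/
def cxxyD (c : (Fin n → ℝ) → (Fin n → ℝ) → ℝ) (i j l : Fin n) (x y : Fin n → ℝ) : ℝ :=
  pd l (fun z => cxxM c x z i j) y

/-- The mapping `Tu = Y(·, Du)`. -/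
def Tmap (Y : (Fin n → ℝ) → (Fin n → ℝ) → (Fin n → ℝ)) (u : (Fin n → ℝ) → ℝ)
    (x : Fin n → ℝ) : Fin n → ℝ :=
  Y x (gradv u x)

/-- The matrix `w = D²u − c_{xx}(·, Tu)`. -/
def wMat (c : (Fin n → ℝ) → (Fin n → ℝ) → ℝ)
    (Y : (Fin n → ℝ) → (Fin n → ℝ) → (Fin n → ℝ)) (u : (Fin n → ℝ) → ℝ)
    (x : Fin n → ℝ) : Matrix (Fin n) (Fin n) ℝ :=
  hessM u x - cxxM c x (Tmap Y u x)

/-- `A(x,p) = c_{xx}(x, Y(x,p))`. -/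
def AMat (c : (Fin n → ℝ) → (Fin n → ℝ) → ℝ)
    (Y : (Fin n → ℝ) → (Fin n → ℝ) → (Fin n → ℝ)) (x p : Fin n → ℝ) :
    Matrix (Fin n) (Fin n) ℝ :=
  cxxM c x (Y x p)

/-- `D_{p_k p_l} A_{ij}(x,p)`. -/
def D2pA (c : (Fin n → ℝ) → (Fin n → ℝ) → ℝ)
    (Y : (Fin n → ℝ) → (Fin n → ℝ) → (Fin n → ℝ)) (i j k l : Fin n)
    (x p : Fin n → ℝ) : ℝ :=
  pd k (fun q => pd l (fun r => AMat c Y x r i j) q) p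

/-- Condition (A1): unique solvability of `c_x(x,·) = p` and `c_y(·,y) = q`,
with `Y` the solution map of the first. -/
def CondA1 (c : (Fin n → ℝ) → (Fin n → ℝ) → ℝ)
    (Y : (Fin n → ℝ) → (Fin n → ℝ) → (Fin n → ℝ)) : Prop :=
  (∀ x p : Fin n → ℝ, ∃! y, cxV c x y = p) ∧
  (∀ y q : Fin n → ℝ, ∃! x, cyV c x y = q) ∧
  (∀ x p : Fin n → ℝ, cxV c x (Y x p) = p)

/-- Condition (A2). -/
def CondA2 (c : (Fin n → ℝ) → (Fin n → ℝ) → ℝ) (Ω Ω' : Set (Fin n → ℝ)) : Prop :=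
  ∀ x ∈ closure Ω, ∀ y ∈ closure Ω', (cxyM c x y).det ≠ 0

/-- Condition (A3w). -/
def CondA3w (c : (Fin n → ℝ) → (Fin n → ℝ) → ℝ)
    (Y : (Fin n → ℝ) → (Fin n → ℝ) → (Fin n → ℝ)) (Ω : Set (Fin n → ℝ)) : Prop :=
  ∀ x ∈ Ω, ∀ p ξ η : Fin n → ℝ, (∑ i, ξ i * η i) = 0 →
    0 ≤ ∑ i, ∑ j, ∑ k, ∑ l, D2pA c Y i j k l x p * ξ i * ξ j * η k * η l

/-- Unit outer normal field obtained from a defining function. -/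
def nml (φ : (Fin n → ℝ) → ℝ) (x : Fin n → ℝ) : Fin n → ℝ :=
  (Real.sqrt (∑ i, gradv φ x i ^ 2))⁻¹ • gradv φ x

/-- `φ` is a `C^k` defining function for `Ω`. -/
def DefiningFn (Ω : Set (Fin n → ℝ)) (φ : (Fin n → ℝ) → ℝ) (k : ℕ) : Prop :=
  ContDiff ℝ (k : ℕ∞) φ ∧ (∀ x, x ∈ Ω ↔ φ x < 0) ∧
  (∀ x ∈ frontier Ω, φ x = 0) ∧ (∀ x ∈ frontier Ω, gradv φ x ≠ 0)

/-- The uniform c-convexity inequality (1.20) with constant `δ₀`,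
expressed via the defining function `φ` of `Ω`. -/
def UnifCConvexWith (δ₀ : ℝ) (c : (Fin n → ℝ) → (Fin n → ℝ) → ℝ)
    (Ω Ω' : Set (Fin n → ℝ)) (φ : (Fin n → ℝ) → ℝ) : Prop :=
  ∀ x ∈ frontier Ω, ∀ y ∈ Ω', ∀ τ : Fin n → ℝ,
    (∑ i, τ i ^ 2) = 1 → (∑ i, τ i * nml φ x i) = 0 →
    δ₀ ≤ ∑ i, ∑ j,
      (pd i (fun z => nml φ z j) x
        - ∑ l, ∑ k, (cxyM c x y)⁻¹ l k * cxxyD c i j l x y * nml φ x k) * τ i * τ j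

/-- `Ω` is uniformly c-convex with respect to `Ω'` (via the defining function `φ`). -/
def UnifCConvex (c : (Fin n → ℝ) → (Fin n → ℝ) → ℝ) (Ω Ω' : Set (Fin n → ℝ))
    (φ : (Fin n → ℝ) → ℝ) : Prop :=
  ∃ δ₀ > (0:ℝ), UnifCConvexWith δ₀ c Ω Ω' φ

/-- The swapped cost `c*(x,y) = c(y,x)`. -/
def cswap (c : (Fin n → ℝ) → (Fin n → ℝ) → ℝ) : (Fin n → ℝ) → (Fin n → ℝ) → ℝ :=
  fun x y => c y x

/-- Ellipticity: `w = D²u − c_{xx}(·,Tu)` is positive definite on `S`. -/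
def Elliptic (c : (Fin n → ℝ) → (Fin n → ℝ) → ℝ)
    (Y : (Fin n → ℝ) → (Fin n → ℝ) → (Fin n → ℝ)) (u : (Fin n → ℝ) → ℝ)
    (S : Set (Fin n → ℝ)) : Prop :=
  ∀ x ∈ S, (wMat c Y u x).PosDef

/-- The Monge–Ampère equation (1.14) with right hand side `|det c_{x,y}| ψ`. -/
def MAeq (c : (Fin n → ℝ) → (Fin n → ℝ) → ℝ)
    (Y : (Fin n → ℝ) → (Fin n → ℝ) → (Fin n → ℝ)) (u : (Fin n → ℝ) → ℝ)
    (ψ : (Fin n → ℝ) → ℝ → (Fin n → ℝ) → ℝ) (Ω : Set (Fin n → ℝ)) : Prop :=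
  ∀ x ∈ Ω, (wMat c Y u x).det = |(cxyM c x (Tmap Y u x)).det| * ψ x (u x) (gradv u x)

/-- `u ∈ C^k(Ω̄)`: `u` is `C^k` on an open neighbourhood of the closure of `Ω`. -/
def CkOnClosure (k : ℕ∞) (u : (Fin n → ℝ) → ℝ) (Ω : Set (Fin n → ℝ)) : Prop :=
  ∃ U, IsOpen U ∧ closure Ω ⊆ U ∧ ContDiffOn ℝ k u U

section

open MeasureTheory Set Metric Filter Topology

theorem exists_weights_det_one_add {V : Type*} [AddCommGroup V] [Module ℝ V]
    [FiniteDimensional ℝ V] (s : Finset ℝ) (hs : Module.finrank ℝ V < s.card) :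
    ∃ w : ℝ → ℝ, ∑ t ∈ s, w t = 1 ∧ ∀ M : V →ₗ[ℝ] V,
      LinearMap.det (LinearMap.id + M) = ∑ t ∈ s, w t * LinearMap.det (LinearMap.id + t • M) := by
  classical
  have hinj : InjOn (fun t : ℝ => t) (s : Set ℝ) := fun _ _ _ _ h => h
  have hne : s.Nonempty := Finset.card_pos.1 (by omega)
  refine ⟨fun t => (Lagrange.basis s (fun t => t) t).eval 1, ?_, fun M => ?_⟩
  · rw [← Polynomial.eval_finsetSum, Lagrange.sum_basis hinj hne, Polynomial.eval_one]
  · let b := Module.finBasis ℝ V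
    let A := LinearMap.toMatrix b b M
    let P : Polynomial ℝ :=
      ((Polynomial.X : Polynomial ℝ) • A.map Polynomial.C
        + (1 : Matrix _ _ ℝ).map Polynomial.C).det
    have hP : ∀ t : ℝ, P.eval t = LinearMap.det (LinearMap.id + t • M) := by
      intro t
      rw [← LinearMap.det_toMatrix b]
      simp only [P, map_add, map_smul, LinearMap.toMatrix_id]
      rw [← Polynomial.coe_evalRingHom, RingHom.map_det]
      congr 1
      ext i j
      rcases eq_or_ne i j with rfl | h
      · simp [A]; ring
      · simp [A, h]; ring
    have hdeg : P.degree < s.card := by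
      refine lt_of_le_of_lt Polynomial.degree_le_natDegree ?_
      have := Polynomial.natDegree_det_X_add_C_le A 1
      rw [Fintype.card_fin] at this
      exact_mod_cast lt_of_le_of_lt this hs
    have h1 := congrArg (Polynomial.eval 1) (Lagrange.eq_interpolate (f := P) hinj hdeg)
    rw [hP, one_smul, Lagrange.interpolate_apply, Polynomial.eval_finsetSum] at h1
    rw [h1]
    refine Finset.sum_congr rfl fun t _ => ?_
    rw [Polynomial.eval_mul, Polynomial.eval_C, hP, mul_comm]

/-- A map equal to `g` on the closed unit ball, vanishing off it, is Lipschitz if `g` is Lipschitz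
on the ball and vanishes on the sphere. -/
theorem LipschitzOnWith.lipschitzWith_indicator_closedBall {V W : Type*} [NormedAddCommGroup V]
    [NormedSpace ℝ V] [NormedAddCommGroup W] {g : V → W} {K : NNReal}
    (hg : LipschitzOnWith K g (closedBall 0 1)) (h0 : ∀ x, ‖x‖ = 1 → g x = 0) :
    LipschitzWith K ((closedBall (0 : V) 1).indicator g) := by
  have key : ∀ x ∈ closedBall (0 : V) 1, ∀ y ∉ closedBall (0 : V) 1,
      dist (g x) 0 ≤ K * dist x y := by
    intro x hx y hy
    have hc : ContinuousOn (fun z : V => ‖z‖) (segment ℝ x y) := by fun_prop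
    have := (convex_segment x y).isPreconnected.intermediate_value
      (left_mem_segment ℝ x y) (right_mem_segment ℝ x y) hc
    obtain ⟨z, hz, hz1⟩ := this ⟨by simpa using hx, by simpa using (not_le.1 (by simpa using hy)).le⟩
    simp only at hz1
    rw [← h0 z hz1]
    refine (hg.dist_le_mul x hx z (by simp [hz1])).trans ?_
    gcongr
    rw [← dist_add_dist_of_mem_segment hz]
    exact le_add_of_nonneg_right dist_nonneg
  refine LipschitzWith.of_dist_le_mul fun x y => ?_
  by_cases hx : x ∈ closedBall (0 : V) 1 <;> by_cases hy : y ∈ closedBall (0 : V) 1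
  · rw [indicator_of_mem hx, indicator_of_mem hy]; exact hg.dist_le_mul x hx y hy
  · rw [indicator_of_mem hx, indicator_of_notMem hy]; exact key x hx y hy
  · rw [indicator_of_notMem hx, indicator_of_mem hy, dist_comm, dist_comm x]; exact key y hy x hx
  · rw [indicator_of_notMem hx, indicator_of_notMem hy, dist_self]; positivity

/-- There is no `C¹` retraction onto the unit sphere. -/
theorem not_contDiff_retraction_sphere {V : Type*} [NormedAddCommGroup V] [InnerProductSpace ℝ V]
    [FiniteDimensional ℝ V] (r : V → V) (hr : ContDiff ℝ 1 r) (h1 : ∀ x, ‖r x‖ = 1)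
    (h2 : ∀ x, ‖x‖ = 1 → r x = x) : False := by
  classical
  borelize V
  let μ : Measure V := Measure.addHaar
  let g : V → V := fun x => r x - x
  have hg : ContDiff ℝ 1 g := hr.sub contDiff_id
  obtain ⟨K, hK⟩ : ∃ K, LipschitzOnWith K g (closedBall 0 1) :=
    hg.contDiffOn.exists_lipschitzOnWith one_ne_zero (convex_closedBall 0 1)
      (isCompact_closedBall 0 1)
  have hg0 : ∀ x, ‖x‖ = 1 → g x = 0 := fun x hx => by simp [g, h2 x hx]
  let G := (closedBall (0 : V) 1).indicator g
  have hG : LipschitzWith K G := hK.lipschitzWith_indicator_closedBall hg0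
  have hGball : ∀ x ∈ ball (0 : V) 1, G x = g x := fun x hx =>
    indicator_of_mem (ball_subset_closedBall hx) g
  have hGout : ∀ x ∉ ball (0 : V) 1, G x = 0 := by
    intro x hx
    by_cases hx' : x ∈ closedBall (0 : V) 1
    · rw [show G x = g x from indicator_of_mem hx' g]
      apply hg0
      simp at hx hx'
      exact le_antisymm hx' hx
    · exact indicator_of_notMem hx' g
  let D : V → V →L[ℝ] V := fderiv ℝ g
  have hD : Continuous D := hg.continuous_fderiv one_ne_zero
  -- uniformly small parameters keep the determinant positive
  have hdet : ∃ ε > 0, ∀ t : ℝ, |t| < ε → ∀ x ∈ closedBall (0 : V) 1,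
      0 < (ContinuousLinearMap.id ℝ V + t • D x).det := by
    have : ∀ x ∈ closedBall (0 : V) 1, ∀ᶠ z : V × ℝ in 𝓝 x ×ˢ 𝓝 0,
        0 < (ContinuousLinearMap.id ℝ V + z.2 • D z.1).det := by
      intro x _
      rw [← nhds_prod_eq]
      have hc : Continuous fun z : V × ℝ => (ContinuousLinearMap.id ℝ V + z.2 • D z.1).det := by
        refine ContinuousLinearMap.continuous_det.comp ?_
        fun_prop
      refine hc.continuousAt.eventually (lt_mem_nhds ?_)
      simp [ContinuousLinearMap.det]
    have := (isCompact_closedBall (0 : V) 1).eventually_forall_of_forall_eventually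
      (x₀ := (0 : ℝ)) (P := fun t x => 0 < (ContinuousLinearMap.id ℝ V + t • D x).det)
      (fun x hx => by
        have := this x hx
        rw [← nhds_prod_eq] at this
        exact (continuous_swap.tendsto (0, x)).eventually this)
    obtain ⟨ε, hε, h⟩ := Metric.eventually_nhds_iff.1 this
    exact ⟨ε, hε, fun t ht x hx => h (by simpa using ht) x hx⟩
  obtain ⟨ε, hε, hdet⟩ := hdet
  have hvol : ∀ t : ℝ, 0 < t → t < ε → t * K < 1 →
      ∫ x in ball (0 : V) 1, (ContinuousLinearMap.id ℝ V + t • D x).det ∂μ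
        = μ.real (ball (0 : V) 1) := by
    intro t ht htε htK
    let f : V → V := fun x => x + t • G x
    have hf : ApproximatesLinearOn f ((ContinuousLinearEquiv.refl ℝ V : V ≃L[ℝ] V) : V →L[ℝ] V)
        univ (Real.toNNReal t * K) := by
      rw [ApproximatesLinearOn.approximatesLinearOn_iff_lipschitzOnWith, lipschitzOnWith_univ]
      have : (f - ((ContinuousLinearEquiv.refl ℝ V : V ≃L[ℝ] V) : V →L[ℝ] V)) = fun x => t • G x := by
        ext x; simp [f]
      rw [this]
      refine LipschitzWith.of_dist_le_mul fun x y => ?_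
      rw [dist_smul₀, NNReal.coe_mul, mul_assoc, Real.norm_eq_abs, abs_of_pos ht,
        Real.coe_toNNReal t ht.le]
      exact mul_le_mul_of_nonneg_left (hG.dist_le_mul x y) ht.le
    have hlt : Subsingleton V ∨ (Real.toNNReal t * K : NNReal) <
        ‖((ContinuousLinearEquiv.refl ℝ V : V ≃L[ℝ] V).symm : V →L[ℝ] V)‖₊⁻¹ := by
      rcases subsingleton_or_nontrivial V with h | h
      · exact Or.inl h
      · right
        simp only [ContinuousLinearEquiv.refl_symm, ContinuousLinearEquiv.coe_refl,
          ContinuousLinearMap.nnnorm_id, inv_one]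
        rw [← NNReal.coe_lt_coe, NNReal.coe_mul, Real.coe_toNNReal t ht.le]
        exact_mod_cast htK
    have hinj : Function.Injective f := by
      have := hf.injective hlt
      intro x y hxy
      exact congrArg Subtype.val (this (a₁ := ⟨x, trivial⟩) (a₂ := ⟨y, trivial⟩) hxy)
    have hsurj := hf.surjective hlt
    have hfout : ∀ x ∉ ball (0 : V) 1, f x = x := fun x hx => by simp [f, hGout x hx]
    have himg : f '' ball (0 : V) 1 = ball 0 1 := by
      ext y
      constructor
      · rintro ⟨x, hx, rfl⟩
        by_contra hy
        have := hinj (hfout _ hy)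
        rw [this] at hy
        exact hy hx
      · intro hy
        obtain ⟨x, rfl⟩ := hsurj y
        refine ⟨x, ?_, rfl⟩
        by_contra hx
        rw [hfout x hx] at hy
        exact hx hy
    have hder : ∀ x ∈ ball (0 : V) 1,
        HasFDerivWithinAt f (ContinuousLinearMap.id ℝ V + t • D x) (ball 0 1) x := by
      intro x hx
      have h3 : HasFDerivAt (fun x => x + t • g x) (ContinuousLinearMap.id ℝ V + t • D x) x :=
        (hasFDerivAt_id x).add ((hg.differentiable one_ne_zero x).hasFDerivAt.const_smul t)
      refine h3.hasFDerivWithinAt.congr (fun y hy => ?_) ?_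
      · simp [f, hGball y hy]
      · simp [f, hGball x hx]
    have := integral_image_eq_integral_abs_det_fderiv_smul μ measurableSet_ball hder
      hinj.injOn (fun _ => (1 : ℝ))
    rw [himg] at this
    simp only [integral_const, smul_eq_mul, mul_one, measureReal_restrict_apply_univ] at this
    rw [this]
    refine setIntegral_congr_fun measurableSet_ball fun x hx => ?_
    exact (abs_of_pos (hdet t (by rwa [abs_of_pos ht]) x (ball_subset_closedBall hx))).symm
  obtain ⟨ε', hε', hε'1, hε'K⟩ : ∃ ε' > 0, ε' ≤ ε ∧ ∀ t : ℝ, 0 < t → t < ε' → t * K < 1 := by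
    refine ⟨min ε (1 / (K + 1)), by positivity, min_le_left _ _, fun t ht h => ?_⟩
    have h5 : t < 1 / (K + 1) := lt_of_lt_of_le h (min_le_right _ _)
    rw [lt_div_iff₀ (by positivity)] at h5
    nlinarith
  obtain ⟨s, hs, hcard⟩ := (Ioo_infinite hε').exists_subset_card_eq (Module.finrank ℝ V + 1)
  obtain ⟨w, hw1, hw⟩ := exists_weights_det_one_add (V := V) s (by omega)
  have hdet1 : ∀ M : V →L[ℝ] V, (ContinuousLinearMap.id ℝ V + M).det
      = ∑ t ∈ s, w t * (ContinuousLinearMap.id ℝ V + t • M).det := fun M => hw M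
  have h_integral : ∫ x in ball (0 : V) 1, (ContinuousLinearMap.id ℝ V + D x).det ∂μ
      = μ.real (ball (0 : V) 1) := by
    rw [funext fun x => hdet1 (D x), integral_finsetSum]
    · simp_rw [integral_const_mul]
      rw [Finset.sum_congr rfl fun t ht => by
        rw [hvol t (hs ht).1 ((hs ht).2.trans_le hε'1) (hε'K t (hs ht).1 (hs ht).2)]]
      rw [← Finset.sum_mul, hw1, one_mul]
    · intro t _
      have hc : Continuous fun x => w t * (ContinuousLinearMap.id ℝ V + t • D x).det := by
        refine continuous_const.mul (ContinuousLinearMap.continuous_det.comp ?_)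
        fun_prop
      exact (hc.continuousOn.integrableOn_compact (isCompact_closedBall (0 : V) 1)).mono_set
        ball_subset_closedBall
  have hzero : ∀ x : V, (ContinuousLinearMap.id ℝ V + D x).det = 0 := by
    intro x
    by_contra hne
    have hd : HasFDerivAt r (ContinuousLinearMap.id ℝ V + D x) x := by
      have : HasFDerivAt (fun x => x + g x) (ContinuousLinearMap.id ℝ V + D x) x :=
        (hasFDerivAt_id x).add (hg.differentiable one_ne_zero x).hasFDerivAt
      simpa [g] using this
    have hsq : HasFDerivAt (fun y => inner ℝ (r y) (r y)) _ x := hd.inner ℝ hd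
    have hconst : (fun y => inner ℝ (r y) (r y)) = fun _ => (1 : ℝ) := by
      ext y; rw [real_inner_self_eq_norm_sq, h1]; norm_num
    rw [hconst] at hsq
    have h0 := hsq.unique (hasFDerivAt_const (1 : ℝ) x)
    have hsurj : Function.Surjective (ContinuousLinearMap.id ℝ V + D x) :=
      (LinearMap.equivOfDetNeZero _ hne).surjective
    obtain ⟨v, hv⟩ := hsurj (r x)
    have h3 := DFunLike.congr_fun h0 v
    simp only [ContinuousLinearMap.comp_apply, ContinuousLinearMap.prod_apply,
      fderivInnerCLM_apply, hv, real_inner_self_eq_norm_sq, h1] at h3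
    norm_num at h3
  simp_rw [hzero] at h_integral
  have hpos : 0 < μ.real (ball (0 : V) 1) :=
    ENNReal.toReal_pos (measure_ball_pos μ 0 one_pos).ne' measure_ball_lt_top.ne
  simp at h_integral
  rw [← h_integral] at hpos
  exact lt_irrefl _ hpos

theorem exists_eq_zero_of_eq_self_of_norm_ge {V : Type*} [NormedAddCommGroup V]
    [InnerProductSpace ℝ V] [FiniteDimensional ℝ V] {φ : V → V} (hφ : Continuous φ) {R : ℝ}
    (hR : 0 ≤ R) (h : ∀ x, R ≤ ‖x‖ → φ x = x) : ∃ x, φ x = 0 := by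
  by_contra! hne
  obtain ⟨g, hg, hgφ, hgS, -⟩ := hφ.exists_contDiff_approx_and_eqOn (n := 1) hφ.norm
    (fun x => norm_pos_iff.2 (hne x)) (S := {x | R + 1 ≤ ‖x‖}) (U := {x | R < ‖x‖})
    (isClosed_le continuous_const continuous_norm)
    ((isOpen_lt continuous_const continuous_norm).mem_nhdsSet.2
      fun x (hx : R + 1 ≤ ‖x‖) => show R < ‖x‖ by linarith)
    (contDiffOn_id.congr fun x hx => h x (le_of_lt hx))
  have hg0 : ∀ x, g x ≠ 0 := by
    intro x hx
    have := hgφ x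
    rw [hx, dist_zero_left] at this
    exact lt_irrefl _ this
  have hg' : ContDiff ℝ 1 fun x : V => g ((R + 1) • x) := by
    exact hg.comp (contDiff_const_smul _)
  refine not_contDiff_retraction_sphere (fun x => ‖g ((R + 1) • x)‖⁻¹ • g ((R + 1) • x)) ?_ ?_ ?_
  · exact ((hg'.norm ℝ fun x => hg0 _).inv fun x => norm_ne_zero_iff.2 (hg0 _)).smul hg'
  · intro x
    rw [norm_smul, norm_inv, norm_norm, inv_mul_cancel₀ (norm_ne_zero_iff.2 (hg0 _))]
  · intro x hx
    have hn : ‖(R + 1) • x‖ = R + 1 := by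
      rw [norm_smul, hx, mul_one, Real.norm_eq_abs, abs_of_nonneg (by linarith)]
    have : g ((R + 1) • x) = (R + 1) • x := by
      rw [hgS (show R + 1 ≤ ‖(R + 1) • x‖ from hn.ge), h _ (by rw [hn]; linarith)]
    simp only [this, hn]
    rw [smul_smul, inv_mul_cancel₀ (by linarith), one_smul]

theorem exists_eq_zero_of_norm_sub_self_le {V : Type*} [NormedAddCommGroup V]
    [InnerProductSpace ℝ V] [FiniteDimensional ℝ V] {ψ : V → V}
    (hψ : ContinuousOn ψ (closedBall 0 1)) (h : ∀ x ∈ closedBall (0 : V) 1, ‖ψ x - x‖ ≤ 1) :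
    ∃ x ∈ closedBall (0 : V) 1, ψ x = 0 := by
  let q : V → V := fun x => (max 1 ‖x‖)⁻¹ • x
  have hm : ∀ x : V, 0 < max 1 ‖x‖ := fun x => lt_max_of_lt_left one_pos
  have hq : Continuous q :=
    ((continuous_const.max continuous_norm).inv₀ fun x => (hm x).ne').smul continuous_id
  have hqm : ∀ x, q x ∈ closedBall (0 : V) 1 := by
    intro x
    rw [mem_closedBall_zero_iff, norm_smul, norm_inv, Real.norm_eq_abs, abs_of_pos (hm x),
      inv_mul_le_iff₀ (hm x), mul_one]
    exact le_max_right _ _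
  let χ : V → ℝ := fun x => min 1 (max 0 (2 - ‖x‖))
  have hχ : Continuous χ := by fun_prop
  let φ : V → V := fun x => x + χ x • (ψ (q x) - q x)
  have hφ : Continuous φ :=
    continuous_id.add (hχ.smul ((hψ.comp_continuous hq hqm).sub hq))
  obtain ⟨x, hx⟩ := exists_eq_zero_of_eq_self_of_norm_ge hφ (R := 2) (by norm_num) (by
    intro x hx
    have : χ x = 0 := by
      simp only [χ]
      rw [max_eq_left (by linarith)]
      norm_num
    simp [φ, this])
  have hχ0 : 0 ≤ χ x := le_min zero_le_one (le_max_left _ _)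
  have hχ1 : χ x ≤ 1 := min_le_left _ _
  have hx1 : ‖x‖ ≤ 1 := by
    have hx' : x = -(χ x • (ψ (q x) - q x)) := eq_neg_of_add_eq_zero_left hx
    have h3 := h _ (hqm x)
    rw [hx', norm_neg, norm_smul, Real.norm_eq_abs, abs_of_nonneg hχ0]
    nlinarith [norm_nonneg (ψ (q x) - q x)]
  have hqx : q x = x := by simp [q, max_eq_left hx1]
  have hχx : χ x = 1 := by
    simp only [χ]
    exact min_eq_left (le_max_of_le_right (by linarith))
  refine ⟨x, by simpa using hx1, ?_⟩
  simpa [φ, hqx, hχx] using hx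

theorem mem_interior_image_closedBall {V : Type*} [NormedAddCommGroup V]
    [InnerProductSpace ℝ V] [FiniteDimensional ℝ V] {f : V → V}
    (hf : ContinuousOn f (closedBall 0 1)) (hinj : InjOn f (closedBall 0 1)) :
    f 0 ∈ interior (f '' closedBall 0 1) := by
  classical
  borelize V
  let B := closedBall (0 : V) 1
  have hB : IsCompact B := isCompact_closedBall 0 1
  have h0B : (0 : V) ∈ B := mem_closedBall_self zero_le_one
  set K := f '' B with hKdef
  have hK : IsCompact K := hB.image_of_continuousOn hf
  obtain ⟨G, hG, hGf⟩ : ∃ G : V → V, Continuous G ∧ ∀ x ∈ B, G (f x) = x := by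
    have hcB : CompactSpace B := isCompact_iff_compactSpace.1 hB
    have hemb : IsClosedEmbedding (B.domRestrict f) :=
      (continuousOn_iff_continuous_domRestrict.1 hf).isClosedEmbedding (injOn_iff_injective.1 hinj)
    obtain ⟨G, hG⟩ := ContinuousMap.exists_extension hemb
      (⟨Subtype.val, continuous_subtype_val⟩ : C(B, V))
    exact ⟨G, G.continuous, fun x hx => congrArg (fun k => k ⟨x, hx⟩) hG⟩
  by_contra h_integral
  have hG0 : G (f 0) = 0 := hGf 0 h0B
  obtain ⟨ε, hε, hGε⟩ : ∃ ε > 0, ∀ y, dist y (f 0) < 3 * ε → ‖G y‖ < 1 / 10 := by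
    obtain ⟨ε, hε, h⟩ := Metric.continuous_iff.1 hG (f 0) (1 / 10) (by norm_num)
    refine ⟨ε / 3, by positivity, fun y hy => ?_⟩
    have := h y (by linarith)
    rwa [hG0, dist_zero_right] at this
  obtain ⟨c, hc, hcK⟩ : ∃ c, dist c (f 0) < ε ∧ c ∉ K := by
    by_contra! hcon
    exact h_integral (mem_interior_iff_mem_nhds.2 (Metric.mem_nhds_iff.2 ⟨ε, hε, fun c hc => hcon c hc⟩))
  obtain ⟨δ, hδ, hδ1, hGδ⟩ : ∃ δ > 0, δ ≤ 1 / 10 ∧ ∀ y ∈ K, ε ≤ dist y c → δ ≤ ‖G y‖ := by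
    have hS : IsCompact (K ∩ {y | ε ≤ dist y c}) :=
      hK.inter_right (isClosed_le continuous_const (continuous_id.dist continuous_const))
    have hpos : ∀ y ∈ K ∩ {y | ε ≤ dist y c}, 0 < ‖G y‖ := by
      rintro y ⟨⟨x, hx, rfl⟩, hy⟩
      rw [norm_pos_iff, hGf x hx]
      rintro rfl
      rw [dist_comm] at hc
      exact absurd hc (not_lt.2 hy)
    obtain ⟨δ, hδ, h⟩ := hS.exists_forall_le' hG.norm.continuousOn hpos
    exact ⟨min δ (1 / 10), by positivity, min_le_right _ _,
      fun y hy hyc => (min_le_left _ _).trans (h y ⟨hy, hyc⟩)⟩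
  obtain ⟨P₀, hP₀, hP₀G, -⟩ := hG.exists_contDiff_approx (n := 1) (ε := fun _ => δ / 2)
    continuous_const (fun _ => by positivity)
  obtain ⟨v, hv, hvP⟩ : ∃ v : V, ‖v‖ < δ / 2 ∧ v ∉ P₀ '' sphere c ε := by
    have hnull : (Measure.addHaar : Measure V) (P₀ '' sphere c ε) = 0 :=
      addHaar_image_eq_zero_of_differentiableOn_of_addHaar_eq_zero _
        (hP₀.differentiable one_ne_zero).differentiableOn
        (Measure.addHaar_sphere_of_ne_zero _ c hε.ne')
    by_contra! hcon
    have hsub : ball (0 : V) (δ / 2) ⊆ P₀ '' sphere c ε := fun v hv =>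
      hcon v (by simpa using hv)
    exact (measure_ball_pos (Measure.addHaar : Measure V) 0 (half_pos hδ)).ne'
      (measure_mono_null hsub hnull)
  let P : V → V := fun y => P₀ y - v
  have hP : Continuous P := hP₀.continuous.sub continuous_const
  have hPG : ∀ y, ‖P y - G y‖ < δ := by
    intro y
    have h1 := hP₀G y
    rw [dist_eq_norm] at h1
    have : P y - G y = (P₀ y - G y) - v := by simp only [P]; abel
    rw [this]
    linarith [norm_sub_le (P₀ y - G y) v]
  have hPs : ∀ y ∈ sphere c ε, P y ≠ 0 := fun y hy h =>
    hvP ⟨y, hy, sub_eq_zero.1 h⟩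
  let Φ : V → V := fun y => c + max (ε / dist y c) 1 • (y - c)
  have hcd : ∀ y ∈ K, 0 < dist y c := fun y hy => dist_pos.2 fun h => hcK (h ▸ hy)
  have hΦ : ContinuousOn Φ K := by
    have : ContinuousOn (fun y => ε / dist y c) K :=
      continuousOn_const.div (by fun_prop) fun y hy => (hcd y hy).ne'
    exact continuousOn_const.add ((this.sup continuousOn_const).smul (by fun_prop))
  have hΦ1 : ∀ y ∈ K, ε ≤ dist y c → Φ y = y := by
    intro y hy hyc
    simp only [Φ]
    rw [max_eq_right ((div_le_one (hcd y hy)).2 hyc)]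
    simp
  have hΦ2 : ∀ y ∈ K, dist y c < ε → Φ y ∈ sphere c ε := by
    intro y hy hyc
    have h0 := hcd y hy
    simp only [Φ]
    rw [max_eq_left ((one_le_div h0).2 hyc.le), mem_sphere, dist_eq_norm, add_sub_cancel_left,
      norm_smul, Real.norm_eq_abs, abs_of_pos (by positivity), ← dist_eq_norm]
    field_simp
  have hne : ∀ y ∈ K, P (Φ y) ≠ 0 := by
    intro y hy
    rcases le_or_gt ε (dist y c) with h | h
    · rw [hΦ1 y hy h]
      intro h0
      have h1 := hPG y
      rw [h0, zero_sub, norm_neg] at h1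
      exact absurd h1 (not_lt.2 (hGδ y hy h))
    · exact hPs _ (hΦ2 y hy h)
  obtain ⟨x, hx, hx0⟩ := exists_eq_zero_of_norm_sub_self_le (ψ := fun x => P (Φ (f x)))
    (hP.comp_continuousOn (hΦ.comp hf (mapsTo_image f B))) (by
      intro x hx
      have hy : f x ∈ K := mem_image_of_mem f hx
      have h1 : ‖P (Φ (f x)) - G (f x)‖ ≤ 1 := by
        rcases le_or_gt ε (dist (f x) c) with h | h
        · rw [hΦ1 _ hy h]
          linarith [hPG (f x)]
        · have h2 := hGε (f x) (by linarith [dist_triangle (f x) c (f 0)])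
          have h3 := hGε (Φ (f x)) (by
            have := hΦ2 _ hy h
            rw [mem_sphere] at this
            linarith [dist_triangle (Φ (f x)) c (f 0)])
          have h4 := hPG (Φ (f x))
          have : P (Φ (f x)) - G (f x)
              = (P (Φ (f x)) - G (Φ (f x))) + (G (Φ (f x)) - G (f x)) := by abel
          rw [this]
          linarith [norm_add_le (P (Φ (f x)) - G (Φ (f x))) (G (Φ (f x)) - G (f x)),
            norm_sub_le (G (Φ (f x))) (G (f x))]
      rwa [hGf x hx] at h1)
  exact hne _ (mem_image_of_mem f hx) hx0

/-- **Invariance of domain**, for maps defined on the whole space. -/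
theorem Continuous.isOpenMap_of_injective {V : Type*} [NormedAddCommGroup V] [NormedSpace ℝ V]
    [FiniteDimensional ℝ V] {f : V → V} (hf : Continuous f) (hinj : Function.Injective f) :
    IsOpenMap f := by
  suffices H : ∀ g : EuclideanSpace ℝ (Fin (Module.finrank ℝ V)) → _, Continuous g →
      Function.Injective g → IsOpenMap g by
    let e : V ≃L[ℝ] EuclideanSpace ℝ (Fin (Module.finrank ℝ V)) := toEuclidean
    have := H (fun x => e (f (e.symm x))) (by fun_prop)
      (e.injective.comp (hinj.comp e.symm.injective))
    have h2 := e.symm.toHomeomorph.isOpenMap.comp (this.comp e.toHomeomorph.isOpenMap)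
    convert h2 using 1
    ext x
    simp
  intro g hg hgi
  refine isOpenMap_iff_nhds_le.2 fun x => ?_
  intro N hN
  obtain ⟨s, hs, hsN⟩ := Metric.nhds_basis_closedBall.mem_iff.1 (mem_map.1 hN)
  have h1 := mem_interior_image_closedBall (f := fun z => g (x + s • z))
    (by fun_prop) (fun a _ b _ hab => by
      have := hgi hab
      simpa [hs.ne'] using this)
  simp only [smul_zero, add_zero] at h1
  refine mem_of_superset (mem_interior_iff_mem_nhds.1 h1) ?_
  rintro _ ⟨z, hz, rfl⟩
  apply hsN
  rw [mem_closedBall, dist_eq_norm, add_sub_cancel_left, norm_smul, Real.norm_eq_abs,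
    abs_of_pos hs]
  rw [mem_closedBall_zero_iff] at hz
  nlinarith

section Barrier

variable {E : Type*} [NormedAddCommGroup E]

/-- `K` is a compact neighbourhood of `x` in `U` on whose boundary `f · y` exceeds `f x y`. -/
structure IsBarrier (f : E → E → ℝ) (U K : Set E) (x y : E) : Prop where
  isCompact : IsCompact K
  subset : K ⊆ U
  mem : x ∈ K
  lt : ∀ z ∈ frontier K, f x y < f z y

/-- Some compact subset of `U` is a barrier for `f · y` around `x`. -/
def HasBarrier (f : E → E → ℝ) (U : Set E) (x y : E) : Prop :=
  ∃ K, IsBarrier f U K x y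

variable {f : E → E → ℝ} {U : Set E}

theorem IsBarrier.mem_interior {K : Set E} {x y : E} (h : IsBarrier f U K x y) :
    x ∈ interior K := by
  by_contra hx
  exact lt_irrefl _ (h.lt x ⟨subset_closure h.mem, hx⟩)

theorem ContinuousOn.continuousAt_uncurry (hU : IsOpen U)
    (hf : ContinuousOn (Function.uncurry f) (U ×ˢ univ)) {x : E} (hx : x ∈ U) (y : E) :
    ContinuousAt (Function.uncurry f) (x, y) :=
  hf.continuousAt ((hU.prod isOpen_univ).mem_nhds ⟨hx, trivial⟩)

theorem ContinuousOn.continuousOn_left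
    (hf : ContinuousOn (Function.uncurry f) (U ×ˢ univ)) (y : E) :
    ContinuousOn (fun x => f x y) U :=
  hf.comp (by fun_prop : ContinuousOn (fun x => (x, y)) U) fun _ hx => ⟨hx, trivial⟩

theorem ContinuousOn.continuous_right
    (hf : ContinuousOn (Function.uncurry f) (U ×ˢ univ)) {x : E} (hx : x ∈ U) :
    Continuous (f x) :=
  hf.comp_continuous (by fun_prop : Continuous fun y => (x, y)) fun _ => ⟨hx, trivial⟩

theorem IsBarrier.eventually (hU : IsOpen U)
    (hf : ContinuousOn (Function.uncurry f) (U ×ˢ univ)) {K : Set E} {x y : E}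
    (h : IsBarrier f U K x y) : ∀ᶠ p : E × E in 𝓝 (x, y), IsBarrier f U K p.1 p.2 := by
  have hfr : IsCompact (frontier K) :=
    h.isCompact.of_isClosed_subset isClosed_frontier h.isCompact.isClosed.frontier_subset
  have h1 : ∀ᶠ p : E × E in 𝓝 (x, y), ∀ z ∈ frontier K, f p.1 p.2 < f z p.2 := by
    refine hfr.eventually_forall_of_forall_eventually fun z hz => ?_
    have hzU : z ∈ U := h.subset (h.isCompact.isClosed.frontier_subset hz)
    have c1 : ContinuousAt (fun q : (E × E) × E => f q.1.1 q.1.2) ((x, y), z) :=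
      ContinuousAt.comp (f := fun q : (E × E) × E => q.1) (g := Function.uncurry f)
        (hf.continuousAt_uncurry hU (h.subset h.mem) y) continuousAt_fst
    have c2 : ContinuousAt (fun q : (E × E) × E => f q.2 q.1.2) ((x, y), z) :=
      ContinuousAt.comp (f := fun q : (E × E) × E => (q.2, q.1.2)) (g := Function.uncurry f)
        (hf.continuousAt_uncurry hU hzU y) (by fun_prop)
    exact c1.eventually_lt c2 (h.lt z hz)
  have h2 : ∀ᶠ p : E × E in 𝓝 (x, y), p.1 ∈ K :=
    continuous_fst.continuousAt.eventually_mem (mem_interior_iff_mem_nhds.1 h.mem_interior)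
  filter_upwards [h1, h2] with p hp1 hp2
  exact ⟨h.isCompact, h.subset, hp2, hp1⟩

theorem HasBarrier.mem {x y : E} (h : HasBarrier f U x y) : x ∈ U :=
  h.elim fun _ hK => hK.subset hK.mem

theorem HasBarrier.eventually (hU : IsOpen U)
    (hf : ContinuousOn (Function.uncurry f) (U ×ˢ univ)) {x y : E} (h : HasBarrier f U x y) :
    ∀ᶠ p : E × E in 𝓝 (x, y), HasBarrier f U p.1 p.2 := by
  obtain ⟨K, h⟩ := h
  exact (h.eventually hU hf).mono fun p hp => ⟨K, hp⟩

theorem HasBarrier.eventually_left (hU : IsOpen U)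
    (hf : ContinuousOn (Function.uncurry f) (U ×ˢ univ)) {x y : E} (h : HasBarrier f U x y) :
    ∀ᶠ x' in 𝓝 x, HasBarrier f U x' y :=
  (by fun_prop : ContinuousAt (fun x' => (x', y)) x).eventually (h.eventually hU hf)

theorem HasBarrier.eventually_right (hU : IsOpen U)
    (hf : ContinuousOn (Function.uncurry f) (U ×ˢ univ)) {x y : E} (h : HasBarrier f U x y) :
    ∀ᶠ y' in 𝓝 y, HasBarrier f U x y' :=
  (by fun_prop : ContinuousAt (fun y' => (x, y')) y).eventually (h.eventually hU hf)

variable [NormedSpace ℝ E]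

/-- `f · y` decreases locally uniformly in some direction near `x`. -/
def HasDescent (f : E → E → ℝ) (x y : E) : Prop :=
  ∃ V : E, ∃ ρ > 0, ∃ a > 0, ∀ x' ∈ ball x ρ, ∀ t ∈ Icc (0 : ℝ) ρ,
    f (x' + t • V) y ≤ f x' y - a * t

theorem HasDescent.not_isLocalMin {x y : E} (h : HasDescent f x y) {N : Set E} (hN : N ∈ 𝓝 x) :
    ∃ z ∈ N, f z y < f x y := by
  obtain ⟨V, ρ, hρ, a, ha, h⟩ := h
  have hc : Tendsto (fun t : ℝ => x + t • V) (𝓝[>] 0) (𝓝 x) := by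
    have : Continuous fun t : ℝ => x + t • V := by fun_prop
    simpa using (this.tendsto 0).mono_left nhdsWithin_le_nhds
  obtain ⟨t, htN, ht⟩ := ((hc.eventually_mem hN).and (Ioc_mem_nhdsGT hρ)).exists
  refine ⟨_, htN, ?_⟩
  have := h x (mem_ball_self hρ) t ⟨ht.1.le, ht.2⟩
  nlinarith [ht.1]

theorem IsBarrier.mem_interior_of_forall_hasDescent
    (hf : ContinuousOn (Function.uncurry f) (U ×ˢ univ)) {K : Set E} {x y x₀ : E}
    (h : IsBarrier f U K x y) (hdesc : ∀ z ∈ U, z ≠ x₀ → HasDescent f z y) :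
    x₀ ∈ interior K ∧ f x₀ y ≤ f x y := by
  obtain ⟨z, hzK, hz⟩ := h.isCompact.exists_isMinOn ⟨x, h.mem⟩
    ((hf.continuousOn_left y).mono h.subset)
  have hzi : z ∈ interior K := by
    by_contra hzi
    exact absurd (hz h.mem) (not_le.2 (h.lt z ⟨subset_closure hzK, hzi⟩))
  have : z = x₀ := by
    by_contra hne
    obtain ⟨w, hw, hlt⟩ := (hdesc z (h.subset hzK) hne).not_isLocalMin (mem_interior_iff_mem_nhds.1 hzi)
    exact absurd (hz hw) (not_le.2 hlt)
  subst this
  exact ⟨hzi, hz h.mem⟩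

theorem IsBarrier.mem_interior_of_le
    (hf : ContinuousOn (Function.uncurry f) (U ×ˢ univ)) {K : Set E} {x x' y x₀ : E}
    (h : IsBarrier f U K x y) (hdesc : ∀ z ∈ U, z ≠ x₀ → HasDescent f z y)
    (h' : HasBarrier f U x' y) (hle : f x' y ≤ f x y) : x' ∈ interior K := by
  obtain ⟨K', h'⟩ := h'
  by_contra hx'
  obtain ⟨z, hzC, hz⟩ := (h'.isCompact.diff isOpen_interior).exists_isMinOn ⟨x', h'.mem, hx'⟩
    ((hf.continuousOn_left y).mono (sdiff_subset.trans h'.subset))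
  have hzx' : f z y ≤ f x' y := hz ⟨h'.mem, hx'⟩
  have hzi : z ∈ interior K' := by
    by_contra hzi
    exact absurd hzx' (not_le.2 (h'.lt z ⟨subset_closure hzC.1, hzi⟩))
  have hzK : z ∉ K := fun hzK =>
    absurd (hzx'.trans hle) (not_le.2 (h.lt z ⟨subset_closure hzK, hzC.2⟩))
  have hne : z ≠ x₀ := by
    rintro rfl
    exact hzC.2 (h.mem_interior_of_forall_hasDescent hf hdesc).1
  have hN : interior K' ∩ Kᶜ ∈ 𝓝 z :=
    (isOpen_interior.inter h.isCompact.isClosed.isOpen_compl).mem_nhds ⟨hzi, hzK⟩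
  obtain ⟨w, hw, hlt⟩ := (hdesc z (h'.subset hzC.1) hne).not_isLocalMin hN
  exact absurd (hz ⟨interior_subset hw.1, fun hwK => hw.2 (interior_subset hwK)⟩) (not_le.2 hlt)

/-- A limit of barriers survives as long as some higher point still has a barrier. -/
theorem HasBarrier.of_frequently (hU : IsOpen U)
    (hf : ContinuousOn (Function.uncurry f) (U ×ˢ univ)) {Z : Set E} {X : E → E}
    (hdesc : ∀ y ∈ Z, ∀ z ∈ U, z ≠ X y → HasDescent f z y) {x x' y : E}
    (hfr : ∃ᶠ y' in 𝓝 y, y' ∈ Z ∧ HasBarrier f U x y') (h' : HasBarrier f U x' y)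
    (hlt : f x y < f x' y) : HasBarrier f U x y := by
  obtain ⟨K, hK⟩ := h'
  have hxU : x ∈ U := hfr.exists.elim fun _ h => h.2.mem
  have hKev : ∀ᶠ y' in 𝓝 y, IsBarrier f U K x' y' :=
    (by fun_prop : ContinuousAt (fun y' => (x', y')) y).eventually (hK.eventually hU hf)
  have hltev : ∀ᶠ y' in 𝓝 y, f x y' < f x' y' :=
    (hf.continuous_right hxU).continuousAt.eventually_lt
      (hf.continuous_right (hK.subset hK.mem)).continuousAt hlt
  obtain ⟨y', ⟨hyZ, hb⟩, hK', hlt'⟩ := (hfr.and_eventually (hKev.and hltev)).exists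
  have := hK'.mem_interior_of_le hf (hdesc y' hyZ) hb hlt'.le
  exact ⟨K, hK.isCompact, hK.subset, interior_subset this, fun z hz => hlt.trans (hK.lt z hz)⟩

/-- Sublevel sets with barriers cannot stop growing at a level `κ` below which all points with
barriers lie. -/
theorem false_of_forall_hasBarrier_le [FiniteDimensional ℝ E] [Nontrivial E] (hU : IsOpen U)
    (hf : ContinuousOn (Function.uncurry f) (U ×ˢ univ)) {X y : E} {κ : ℝ}
    (hdesc : ∀ z ∈ U, z ≠ X → HasDescent f z y) (hX : HasBarrier f U X y)
    (hcpt : ∃ K, IsCompact K ∧ K ⊆ U ∧ ∀ x, HasBarrier f U x y → x ∈ K)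
    (hle : ∀ x, HasBarrier f U x y → f x y ≤ κ)
    (hsup : ∀ a < κ, ∃ x, HasBarrier f U x y ∧ a < f x y) : False := by
  have : ProperSpace E := FiniteDimensional.proper ℝ E
  let S := {x | HasBarrier f U x y}
  have hSo : IsOpen S := isOpen_iff_mem_nhds.2 fun x hx => HasBarrier.eventually_left hU hf hx
  obtain ⟨K₀, hK₀, hK₀U, hSK₀⟩ := hcpt
  have hclK : closure S ⊆ K₀ := closure_minimal hSK₀ hK₀.isClosed
  have hclc : IsCompact (closure S) := hK₀.of_isClosed_subset isClosed_closure hclK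
  have hclU : closure S ⊆ U := hclK.trans hK₀U
  have hcont : ∀ z ∈ U, ContinuousAt (fun x => f x y) z := fun z hz =>
    (hf.continuousOn_left y).continuousAt (hU.mem_nhds hz)
  have hfrS : ∀ z ∈ frontier S, z ∉ S := fun z hz => by
    rw [hSo.frontier_eq] at hz; exact hz.2
  have hfrκ : ∀ z ∈ frontier S, f z y = κ := by
    intro z hz
    have hzcl : z ∈ closure S := frontier_subset_closure hz
    have hfr : ∃ᶠ x in 𝓝 z, x ∈ S := mem_closure_iff_frequently.1 hzcl
    refine le_antisymm ?_ (not_lt.1 fun hlt => ?_)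
    · by_contra! hlt
      obtain ⟨x, hx, hx'⟩ := (hfr.and_eventually
        ((hcont z (hclU hzcl)).eventually (lt_mem_nhds hlt))).exists
      exact absurd (hle x hx) (not_le.2 hx')
    · obtain ⟨x', ⟨K', hK'⟩, hx'⟩ := hsup _ hlt
      have hzK' : z ∈ closure K' := by
        refine mem_closure_iff_frequently.2 ?_
        refine (hfr.and_eventually
          ((hcont z (hclU hzcl)).eventually (gt_mem_nhds hx'))).mono fun x hx => ?_
        exact interior_subset (hK'.mem_interior_of_le hf hdesc hx.1 hx.2.le)
      rw [hK'.isCompact.isClosed.closure_eq] at hzK'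
      exact hfrS z hz ⟨K', hK'.isCompact, hK'.subset, hzK', fun w hw => hx'.trans (hK'.lt w hw)⟩
  have hsub : ∀ C : Set E, IsPreconnected C → (C ∩ S).Nonempty →
      (∀ q ∈ C, q ∉ S → f q y < κ) → C ⊆ S := by
    intro C hC hne hlt
    refine hC.subset_of_closure_inter_subset hSo hne fun q hq => ?_
    by_contra hqS
    have hqf : q ∈ frontier S := by rw [hSo.frontier_eq]; exact ⟨hq.1, hqS⟩
    exact absurd (hfrκ q hqf) (hlt q hq.2 hqS).ne
  have hloc : ∀ z ∈ closure S, ∀ᶠ q in 𝓝 z, f q y ≤ κ → q ∈ closure S := by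
    intro z hz
    by_cases hzS : z ∈ S
    · filter_upwards [hSo.mem_nhds hzS] with q hq _
      exact subset_closure hq
    have hzf : z ∈ frontier S := by rw [hSo.frontier_eq]; exact ⟨hz, hzS⟩
    obtain ⟨V, ρ, hρ, a, ha, hV⟩ := hdesc z (hclU hz) (by rintro rfl; exact hzS hX)
    have hev : ∀ᶠ w in 𝓝 z, f w y < κ + a * ρ ∧ w ∈ ball z ρ :=
      ((hcont z (hclU hz)).eventually
        (gt_mem_nhds (by
          change f z y < κ + a * ρ
          rw [hfrκ z hzf]
          nlinarith))).and (ball_mem_nhds z hρ)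
    obtain ⟨η, hη, hη'⟩ := Metric.eventually_nhds_iff_ball.1 hev
    filter_upwards [ball_mem_nhds z hη] with q hq hqκ
    obtain ⟨s, hsS, hs⟩ := ((mem_closure_iff_frequently.1 hz).and_eventually
      (ball_mem_nhds z hη)).exists
    have hIcc : IsPreconnected (Icc (0 : ℝ) ρ) := isPreconnected_Icc
    have h1 : (fun t : ℝ => s + t • V) '' Icc 0 ρ ⊆ S := by
      refine hsub _ (hIcc.image _ (by fun_prop)) ⟨s, ⟨0, ⟨le_rfl, hρ.le⟩, by simp⟩, hsS⟩ ?_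
      rintro _ ⟨t, ht, rfl⟩ hnS
      have ht0 : 0 < t := by
        rcases ht.1.eq_or_lt with h | h
        · rw [← h] at hnS; simp at hnS; exact absurd hsS hnS
        · exact h
      have := hV s (hη' s hs).2 t ht
      have := hle s hsS
      simp only
      nlinarith
    have h2 : (fun w : E => w + ρ • V) '' segment ℝ s q ⊆ S := by
      refine hsub _ ((convex_segment s q).isPreconnected.image _ (by fun_prop))
        ⟨s + ρ • V, ⟨s, left_mem_segment ℝ s q, rfl⟩, h1 ⟨ρ, ⟨hρ.le, le_rfl⟩, rfl⟩⟩ ?_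
      rintro _ ⟨w, hw, rfl⟩ -
      have hw' := hη' w ((convex_ball z η).segment_subset hs hq hw)
      have := hV w hw'.2 ρ ⟨hρ.le, le_rfl⟩
      simp only
      linarith [hw'.1]
    have h3 : (fun t : ℝ => q + t • V) '' Ioc 0 ρ ⊆ S := by
      refine hsub _ (isPreconnected_Ioc.image _ (by fun_prop))
        ⟨q + ρ • V, ⟨ρ, ⟨hρ, le_rfl⟩, rfl⟩, h2 ⟨q, right_mem_segment ℝ s q, rfl⟩⟩ ?_
      rintro _ ⟨t, ht, rfl⟩ -
      have := hV q (hη' q hq).2 t ⟨ht.1.le, ht.2⟩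
      simp only
      nlinarith [ht.1]
    have hc : Tendsto (fun t : ℝ => q + t • V) (𝓝[>] 0) (𝓝 q) := by
      have : Continuous fun t : ℝ => q + t • V := by fun_prop
      simpa using (this.tendsto 0).mono_left nhdsWithin_le_nhds
    refine mem_closure_of_tendsto hc ?_
    filter_upwards [Ioc_mem_nhdsGT hρ] with t ht
    exact h3 ⟨t, ht, rfl⟩
  let O := interior {q | q ∈ U ∧ (f q y ≤ κ → q ∈ closure S)}
  have hclO : closure S ⊆ O := fun z hz =>
    mem_interior_iff_mem_nhds.2 ((hU.eventually_mem (hclU hz)).and (hloc z hz))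
  obtain ⟨N, hN, hSN, hNO⟩ := exists_compact_between hclc isOpen_interior hclO
  obtain ⟨z, hz⟩ : (frontier S).Nonempty := by
    by_contra hne
    rcases isClopen_iff.1 (isClopen_iff_frontier_eq_empty.2 (not_nonempty_iff_eq_empty.1 hne)) with
      h | h
    · exact (h ▸ hX : X ∈ (∅ : Set E))
    · have : NoncompactSpace E := NormedSpace.noncompactSpace ℝ E
      exact noncompact_univ E (h ▸ (by simpa [h] using hclc))
  refine hfrS z hz ⟨N, hN, hNO.trans (interior_subset.trans fun q hq => hq.1),
    interior_subset (hSN (frontier_subset_closure hz)), fun q hq => ?_⟩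
  rw [hfrκ z hz]
  by_contra! hle'
  exact hq.2 (hSN ((interior_subset (hNO (hN.isClosed.frontier_subset hq))).2 hle'))

end Barrier

section Barrier
variable {E : Type*} [NormedAddCommGroup E] {f : E → E → ℝ} {U : Set E}

/-- A point `y₁` minimising, with penalty `C * dist y y₀`, the supremum of `f x y` over the points
`x` having a barrier. -/
theorem exists_minimal_level [ProperSpace E] (hU : IsOpen U)
    (hf : ContinuousOn (Function.uncurry f) (U ×ˢ univ)) {X : E → E} {y₀ : E} {r C D m : ℝ}
    (hr : 0 ≤ r) (hC : 0 ≤ C) (hX : ∀ y ∈ closedBall y₀ r, HasBarrier f U (X y) y)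
    (hm : ∀ y ∈ closedBall y₀ r, -m ≤ f (X y) y)
    (hD : ∀ x, HasBarrier f U x y₀ → f x y₀ ≤ D) :
    ∃ y₁ ∈ closedBall y₀ r, ∃ κ ≤ D, C * dist y₁ y₀ ≤ D + m ∧
      (∀ x, HasBarrier f U x y₁ → f x y₁ ≤ κ) ∧
      ∀ y ∈ closedBall y₀ r, ∀ a < κ - C * dist y y₁, ∃ x, HasBarrier f U x y ∧ a < f x y := by
  let φ : E → EReal := fun y => ⨆ (x) (_ : HasBarrier f U x y), ((f x y + C * dist y y₀ : ℝ) : EReal)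
  have hφ : LowerSemicontinuous φ := by
    intro y a ha
    obtain ⟨x, hx, hax⟩ : ∃ x, ∃ (_ : HasBarrier f U x y), a < ((f x y + C * dist y y₀ : ℝ) : EReal) := by
      simpa only [φ, lt_iSup_iff] using ha
    have hc : Continuous fun y => ((f x y + C * dist y y₀ : ℝ) : EReal) := by
      have := hf.continuous_right hx.mem
      exact continuous_coe_real_ereal.comp (by fun_prop)
    filter_upwards [hx.eventually_right hU hf, hc.continuousAt.eventually (lt_mem_nhds hax)]
      with y' h1 h2
    simp only [φ, lt_iSup_iff]
    exact ⟨x, h1, h2⟩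
  obtain ⟨y₁, hy₁, hmin⟩ := (hφ.lowerSemicontinuousOn _).exists_isMinOn
    ⟨y₀, mem_closedBall_self hr⟩ (isCompact_closedBall y₀ r)
  have hge : ∀ y ∈ closedBall y₀ r, ((-m + C * dist y y₀ : ℝ) : EReal) ≤ φ y := by
    intro y hy
    refine le_trans ?_ (le_iSup₂_of_le (X y) (hX y hy) le_rfl)
    exact EReal.coe_le_coe (by linarith [hm y hy])
  have hφ₀ : φ y₀ ≤ (D : EReal) := by
    refine iSup₂_le fun x hx => EReal.coe_le_coe ?_
    simpa using hD x hx
  have hφ₁ : φ y₁ ≤ (D : EReal) := (hmin (mem_closedBall_self hr)).trans hφ₀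
  obtain ⟨v, hv⟩ : ∃ v : ℝ, φ y₁ = v := by
    refine ⟨(φ y₁).toReal, (EReal.coe_toReal (hφ₁.trans_lt (EReal.coe_lt_top D)).ne ?_).symm⟩
    exact ((EReal.bot_lt_coe _).trans_le (hge y₁ hy₁)).ne'
  have hvD : v ≤ D := by rw [hv] at hφ₁; exact EReal.coe_le_coe_iff.1 hφ₁
  have hvm : -m + C * dist y₁ y₀ ≤ v := by
    have := hge y₁ hy₁; rw [hv] at this; exact EReal.coe_le_coe_iff.1 this
  refine ⟨y₁, hy₁, v - C * dist y₁ y₀, ?_, by linarith, fun x hx => ?_, fun y hy a ha => ?_⟩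
  · linarith [mul_nonneg hC (dist_nonneg (x := y₁) (y := y₀))]
  · have : ((f x y₁ + C * dist y₁ y₀ : ℝ) : EReal) ≤ v :=
      hv ▸ le_iSup₂_of_le (f := fun x (_ : HasBarrier f U x y₁) =>
        ((f x y₁ + C * dist y₁ y₀ : ℝ) : EReal)) x hx le_rfl
    linarith [EReal.coe_le_coe_iff.1 this]
  · have h1 : ((a + C * dist y y₀ : ℝ) : EReal) < φ y := by
      refine lt_of_lt_of_le ?_ (hmin hy)
      rw [hv, EReal.coe_lt_coe_iff]
      nlinarith [dist_triangle y y₁ y₀]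
    simp only [φ, lt_iSup_iff, EReal.coe_lt_coe_iff] at h1
    obtain ⟨x, hx, h⟩ := h1
    exact ⟨x, hx, by linarith⟩

theorem HasBarrier.of_isPreconnected [NormedSpace ℝ E] [FiniteDimensional ℝ E] [Nontrivial E] (hU : IsOpen U)
    (hf : ContinuousOn (Function.uncurry f) (U ×ˢ univ)) {X : E → E} {Z Γ : Set E}
    {r D m R C : ℝ} (hr : 0 < r) (hΓZ : ∀ y ∈ Γ, closedBall y r ⊆ Z) (hΓ : IsPreconnected Γ)
    (hdesc : ∀ y ∈ Z, ∀ z ∈ U, z ≠ X y → HasDescent f z y)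
    (hX : ∀ y ∈ Z, HasBarrier f U (X y) y) (hm : ∀ y ∈ Z, -m ≤ f (X y) y)
    (hC : 2 * (D + m) / r < C)
    (hfar : ∀ x ∈ U, R ≤ ‖x‖ → ∀ y ∈ Z, ∀ η > 0, ∃ y', dist y' y < η ∧
      f x y' < f x y - C * dist y' y)
    (hcpt : ∀ y ∈ Z, ∀ a, ∃ K, IsCompact K ∧ K ⊆ U ∧ ∀ x ∈ U, ‖x‖ ≤ R → f x y ≤ a → x ∈ K)
    {x y₀ y₁ : E} (hy₀ : y₀ ∈ Γ) (hx : HasBarrier f U x y₀) (hD : ∀ y ∈ Γ, f x y ≤ D)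
    (hy₁ : y₁ ∈ Γ) : HasBarrier f U x y₁ := by
  have : ProperSpace E := FiniteDimensional.proper ℝ E
  suffices hsub : Γ ⊆ {y | HasBarrier f U x y} from hsub hy₁
  refine hΓ.subset_of_closure_inter_subset
    (isOpen_iff_mem_nhds.2 fun y hy => HasBarrier.eventually_right hU hf hy) ⟨y₀, hy₀, hx⟩ ?_
  rintro yb ⟨hcl, hybΓ⟩
  by_contra hnb
  have hybZ := hΓZ yb hybΓ
  have hfr : ∃ᶠ y in 𝓝 yb, y ∈ Z ∧ HasBarrier f U x y :=
    ((mem_closure_iff_frequently.1 hcl).and_eventually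
      (closedBall_mem_nhds yb hr)).mono fun y hy => ⟨hybZ hy.2, hy.1⟩
  have hleD : ∀ x', HasBarrier f U x' yb → f x' yb ≤ D := by
    intro x' hx'
    by_contra! hlt
    exact hnb (HasBarrier.of_frequently hU hf hdesc hfr hx' ((hD yb hybΓ).trans_lt hlt))
  have hybZ' : yb ∈ Z := hybZ (mem_closedBall_self hr.le)
  have hDm : 0 ≤ D + m := by linarith [hm yb hybZ', hleD _ (hX yb hybZ')]
  have hA : 0 ≤ 2 * (D + m) / r := by positivity
  obtain ⟨C₀, hC₀, hC₀C⟩ := exists_between hC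
  have hC₀pos : 0 < C₀ := hA.trans_lt hC₀
  rw [div_lt_iff₀ hr] at hC₀ hC
  obtain ⟨ys, hys, κ, hκD, hdist, hle, hsup⟩ := exists_minimal_level hU hf hr.le hC₀pos.le
    (fun y hy => hX y (hybZ hy)) (fun y hy => hm y (hybZ hy)) hleD
  have hdist' : dist ys yb < r / 2 := by nlinarith
  have hball : closedBall ys (r / 2) ⊆ closedBall yb r :=
    closedBall_subset_closedBall' (by linarith)
  have hysZ : ys ∈ Z := hybZ hys
  have hnear : ∀ x, HasBarrier f U x ys → ‖x‖ ≤ R := by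
    intro z hz
    by_contra! hzR
    have hzU := hz.mem
    have hcz := hf.continuous_right hzU
    let G := {y | y ∈ closedBall ys (r / 2) ∧ HasBarrier f U z y ∧ f z y + C * dist y ys ≤ f z ys}
    have hGcl : IsClosed G := by
      refine isClosed_of_closure_subset fun y hy => ?_
      have hyb : y ∈ closedBall ys (r / 2) :=
        closure_minimal (fun q (hq : q ∈ G) => hq.1) isClosed_closedBall hy
      have hyle : f z y + C * dist y ys ≤ f z ys :=
        closure_minimal (t := {y | f z y + C * dist y ys ≤ f z ys})
          (fun q (hq : q ∈ G) => hq.2.2) (isClosed_le (by fun_prop) continuous_const) hy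
      refine ⟨hyb, ?_, hyle⟩
      rcases eq_or_ne y ys with rfl | hne
      · exact hz
      have hpos : 0 < dist y ys := dist_pos.2 hne
      obtain ⟨x', hx', hlt⟩ := hsup y (hball hyb) (f z y) (by nlinarith [hle z hz])
      exact HasBarrier.of_frequently hU hf hdesc ((mem_closure_iff_frequently.1 hy).mono
        fun q hq => ⟨hybZ (hball hq.1), hq.2.1⟩) hx' hlt
    have hGc : IsCompact G := (isCompact_closedBall ys (r / 2)).of_isClosed_subset hGcl
      fun q hq => hq.1
    obtain ⟨q, hq, hqmin⟩ := hGc.exists_isMinOn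
      ⟨ys, mem_closedBall_self (by linarith), hz, by simp⟩
      (by fun_prop : ContinuousOn (fun y => f z y + C * dist y ys) G)
    have hqZ : q ∈ Z := hybZ (hball hq.1)
    have hqi : dist q ys < r / 2 := by
      obtain ⟨K, hK⟩ := hq.2.1
      have h1 := (hK.mem_interior_of_forall_hasDescent hf (hdesc q hqZ)).2
      have h2 := hm q hqZ
      have h3 := hq.2.2
      have h4 := hle z hz
      have h5 : 0 < C := hC₀pos.trans hC₀C
      nlinarith
    obtain ⟨η, hη, hη'⟩ := Metric.eventually_nhds_iff.1
      ((hq.2.1.eventually_right hU hf).and (isOpen_ball.eventually_mem (mem_ball.2 hqi)))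
    obtain ⟨q', hq'η, hq'⟩ := hfar z hzU hzR.le q hqZ η hη
    obtain ⟨h1, h2⟩ := hη' hq'η
    have h3 : f z q' + C * dist q' ys < f z q + C * dist q ys := by
      have := dist_triangle q' q ys
      have : 0 < C := hC₀pos.trans hC₀C
      nlinarith
    exact absurd (hqmin ⟨ball_subset_closedBall h2, h1, h3.le.trans hq.2.2⟩) (not_le.2 h3)
  obtain ⟨K, hK, hKU, hxK⟩ := hcpt ys hysZ κ
  refine false_of_forall_hasBarrier_le hU hf (hdesc ys hysZ) (hX ys hysZ)
    ⟨K, hK, hKU, fun x hx => hxK x hx.mem (hnear x hx) (hle x hx)⟩ hle fun a ha => ?_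
  exact hsup ys hys a (by simpa using ha)

end Barrier

section Calculus

theorem fderiv_eq_gradv_dotProduct (f : (Fin n → ℝ) → ℝ) (x v : Fin n → ℝ) :
    fderiv ℝ f x v = gradv f x ⬝ᵥ v := by
  conv_lhs => rw [← Finset.univ_sum_single v]
  rw [map_sum, dotProduct]
  refine Finset.sum_congr rfl fun i _ => ?_
  have : Pi.single i (v i) = v i • (Pi.single i 1 : Fin n → ℝ) := by
    rw [← Pi.single_smul]; simp
  rw [this, map_smul, smul_eq_mul, mul_comm]
  rfl

theorem contDiffOn_gradv {u : (Fin n → ℝ) → ℝ} {O : Set (Fin n → ℝ)} (hO : IsOpen O)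
    (hu : ContDiffOn ℝ 2 u O) : ContDiffOn ℝ 1 (gradv u) O := by
  refine contDiffOn_pi.2 fun i => ?_
  exact (hu.fderiv_of_isOpen hO (m := 1) (by norm_num)).clm_apply contDiffOn_const

variable {c : (Fin n → ℝ) → (Fin n → ℝ) → ℝ}

theorem cxV_apply (hc : ContDiff ℝ 2 (fun q : (Fin n → ℝ) × (Fin n → ℝ) => c q.1 q.2))
    (x y : Fin n → ℝ) (i : Fin n) :
    cxV c x y i
      = fderiv ℝ (fun q : (Fin n → ℝ) × (Fin n → ℝ) => c q.1 q.2) (x, y) (Pi.single i 1, 0) := by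
  have h := ((hc.differentiable two_ne_zero (x, y)).hasFDerivAt).comp x
    (hasFDerivAt_prodMk_left (𝕜 := ℝ) x y)
  exact DFunLike.congr_fun h.fderiv (Pi.single i 1)

theorem cyV_apply (hc : ContDiff ℝ 2 (fun q : (Fin n → ℝ) × (Fin n → ℝ) => c q.1 q.2))
    (x y : Fin n → ℝ) (i : Fin n) :
    cyV c x y i
      = fderiv ℝ (fun q : (Fin n → ℝ) × (Fin n → ℝ) => c q.1 q.2) (x, y) (0, Pi.single i 1) := by
  have h := ((hc.differentiable two_ne_zero (x, y)).hasFDerivAt).comp y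
    (hasFDerivAt_prodMk_right (𝕜 := ℝ) x y)
  exact DFunLike.congr_fun h.fderiv (Pi.single i 1)

theorem contDiff_cxV (hc : ContDiff ℝ 2 (fun q : (Fin n → ℝ) × (Fin n → ℝ) => c q.1 q.2)) :
    ContDiff ℝ 1 (fun q : (Fin n → ℝ) × (Fin n → ℝ) => cxV c q.1 q.2) := by
  refine contDiff_pi.2 fun i => ?_
  simp_rw [cxV_apply hc]
  exact (hc.fderiv_right (m := 1) (by norm_num)).clm_apply contDiff_const

theorem contDiff_cyV (hc : ContDiff ℝ 2 (fun q : (Fin n → ℝ) × (Fin n → ℝ) => c q.1 q.2)) :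
    ContDiff ℝ 1 (fun q : (Fin n → ℝ) × (Fin n → ℝ) => cyV c q.1 q.2) := by
  refine contDiff_pi.2 fun i => ?_
  simp_rw [cyV_apply hc]
  exact (hc.fderiv_right (m := 1) (by norm_num)).clm_apply contDiff_const

/-- The derivative of `c_x` in both variables. -/
def cxVDeriv (c : (Fin n → ℝ) → (Fin n → ℝ) → ℝ) (x y : Fin n → ℝ) :
    (Fin n → ℝ) × (Fin n → ℝ) →L[ℝ] (Fin n → ℝ) :=
  fderiv ℝ (fun q : (Fin n → ℝ) × (Fin n → ℝ) => cxV c q.1 q.2) (x, y)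

theorem hasStrictFDerivAt_cxV
    (hc : ContDiff ℝ 2 (fun q : (Fin n → ℝ) × (Fin n → ℝ) => c q.1 q.2)) (x y : Fin n → ℝ) :
    HasStrictFDerivAt (fun q : (Fin n → ℝ) × (Fin n → ℝ) => cxV c q.1 q.2) (cxVDeriv c x y)
      (x, y) :=
  (contDiff_cxV hc).contDiffAt.hasStrictFDerivAt one_ne_zero

theorem ContinuousLinearMap.apply_eq_sum {F : Type*} [NormedAddCommGroup F] [NormedSpace ℝ F]
    (L : (Fin n → ℝ) →L[ℝ] F) (v : Fin n → ℝ) : L v = ∑ i, v i • L (Pi.single i 1) := by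
  conv_lhs => rw [← Finset.univ_sum_single v]
  rw [map_sum]
  refine Finset.sum_congr rfl fun i _ => ?_
  rw [← map_smul, ← Pi.single_smul]
  simp

theorem fderiv_pi_apply {F ι : Type*} [NormedAddCommGroup F] [NormedSpace ℝ F] [Fintype ι]
    {f : F → ι → ℝ} {x : F} (hf : DifferentiableAt ℝ f x) (v : F) (i : ι) :
    fderiv ℝ (fun z => f z i) x v = fderiv ℝ f x v i :=
  DFunLike.congr_fun ((hasFDerivAt_pi'.1 hf.hasFDerivAt i).fderiv) v

theorem cxyM_mulVec (hc : ContDiff ℝ 2 (fun q : (Fin n → ℝ) × (Fin n → ℝ) => c q.1 q.2))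
    (x y v : Fin n → ℝ) : (cxyM c x y).mulVec v = cxVDeriv c x y (0, v) := by
  have h : HasFDerivAt (fun z => cxV c x z)
      ((cxVDeriv c x y).comp (ContinuousLinearMap.inr ℝ _ _)) y :=
    (hasStrictFDerivAt_cxV hc x y).hasFDerivAt.comp y (hasFDerivAt_prodMk_right x y)
  change _ = ((cxVDeriv c x y).comp (ContinuousLinearMap.inr ℝ _ _)) v
  rw [ContinuousLinearMap.apply_eq_sum]
  ext i
  simp only [Matrix.mulVec, dotProduct, Finset.sum_apply, Pi.smul_apply, smul_eq_mul]
  refine Finset.sum_congr rfl fun j _ => ?_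
  rw [mul_comm, ← h.fderiv, ← fderiv_pi_apply h.differentiableAt]
  rfl

theorem cxVDeriv_injective
    (hc : ContDiff ℝ 2 (fun q : (Fin n → ℝ) × (Fin n → ℝ) => c q.1 q.2)) {x y : Fin n → ℝ}
    (hdet : (cxyM c x y).det ≠ 0) {v : Fin n → ℝ} (hv : cxVDeriv c x y (0, v) = 0) : v = 0 := by
  rw [← cxyM_mulVec hc] at hv
  exact Matrix.eq_zero_of_mulVec_eq_zero hdet hv

/-- The derivative of `x ↦ Du(x) - c_x(x, y)` at `x` is positive definite when `y = Tu(x)`. -/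
theorem Elliptic.dotProduct_pos {Y : (Fin n → ℝ) → (Fin n → ℝ) → (Fin n → ℝ)}
    {u : (Fin n → ℝ) → ℝ} (hc : ContDiff ℝ 2 (fun q : (Fin n → ℝ) × (Fin n → ℝ) => c q.1 q.2))
    {Ω : Set (Fin n → ℝ)} (hell : Elliptic c Y u Ω) {x : Fin n → ℝ} (hx : x ∈ Ω)
    (hg : DifferentiableAt ℝ (gradv u) x) {v : Fin n → ℝ} (hv : v ≠ 0) :
    0 < (fderiv ℝ (gradv u) x v - cxVDeriv c x (Tmap Y u x) (v, 0)) ⬝ᵥ v := by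
  have h1 : HasFDerivAt (fun z => cxV c z (Tmap Y u x))
      ((cxVDeriv c x (Tmap Y u x)).comp (ContinuousLinearMap.inl ℝ _ _)) x :=
    (hasStrictFDerivAt_cxV hc x _).hasFDerivAt.comp (f := fun z => (z, Tmap Y u x)) x
      (hasFDerivAt_prodMk_left x _)
  have h2 := hg.hasFDerivAt.sub h1
  have h3 : fderiv ℝ (gradv u) x v - cxVDeriv c x (Tmap Y u x) (v, 0)
      = Matrix.vecMul v (wMat c Y u x) := by
    change (fderiv ℝ (gradv u) x
      - (cxVDeriv c x (Tmap Y u x)).comp (ContinuousLinearMap.inl ℝ _ _)) v = _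
    rw [ContinuousLinearMap.apply_eq_sum]
    ext j
    simp only [Matrix.vecMul, dotProduct, Finset.sum_apply, Pi.smul_apply, smul_eq_mul]
    refine Finset.sum_congr rfl fun i _ => ?_
    congr 1
    rw [← h1.fderiv, sub_apply, Pi.sub_apply, ← fderiv_pi_apply hg,
      ← fderiv_pi_apply h1.differentiableAt]
    rfl
  rw [h3, ← Matrix.dotProduct_mulVec]
  have := (hell x hx).dotProduct_mulVec_pos hv
  simpa using this

end Calculus

section Local

variable {E : Type*} [NormedAddCommGroup E] [NormedSpace ℝ E]

theorem HasStrictFDerivAt.eventually_add_smul_le {F : E → ℝ} {L : E →L[ℝ] ℝ} {x V : E} {a : ℝ}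
    (h : HasStrictFDerivAt F L x) (hV : L V < -a) :
    ∀ᶠ p in 𝓝 (x, (0 : ℝ)), 0 ≤ p.2 → F (p.1 + p.2 • V) ≤ F p.1 - a * p.2 := by
  have hε : 0 < (-a - L V) / (‖V‖ + 1) := div_pos (by linarith) (by positivity)
  have h1 := h.isLittleO.def hε
  have h2 : Tendsto (fun p : E × ℝ => (p.1 + p.2 • V, p.1)) (𝓝 (x, 0)) (𝓝 (x, x)) := by
    have : Continuous fun p : E × ℝ => (p.1 + p.2 • V, p.1) := by fun_prop
    simpa using this.tendsto (x, 0)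
  filter_upwards [h2.eventually h1] with p hp ht
  simp only [add_sub_cancel_left, map_smul, smul_eq_mul, norm_smul, Real.norm_eq_abs,
    abs_of_nonneg ht] at hp
  have h3 := (abs_le.1 hp).2
  have h4 : (-a - L V) / (‖V‖ + 1) * (p.2 * ‖V‖) ≤ (-a - L V) * p.2 := by
    rw [div_mul_eq_mul_div, div_le_iff₀ (by positivity)]
    nlinarith [mul_nonneg (by linarith : (0:ℝ) ≤ -a - L V) ht]
  linarith

theorem HasDescent.of_eventually {f : E → E → ℝ} {x y V : E} {a : ℝ} (ha : 0 < a)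
    (h : ∀ᶠ p in 𝓝 (x, (0 : ℝ)), 0 ≤ p.2 → f (p.1 + p.2 • V) y ≤ f p.1 y - a * p.2) :
    HasDescent f x y := by
  obtain ⟨ε, hε, h⟩ := Metric.eventually_nhds_iff_ball.1 h
  refine ⟨V, ε / 2, by positivity, a, ha, fun x' hx' t ht => h (x', t) ?_ ht.1⟩
  rw [mem_ball, Prod.dist_eq, max_lt_iff, Real.dist_eq, sub_zero, abs_of_nonneg ht.1]
  exact ⟨(mem_ball.1 hx').trans (half_lt_self hε), ht.2.trans_lt (half_lt_self hε)⟩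

/-- If the images of `Ω'` under `P (x, ·)` are convex, then `Ω'` is locally invariant under small
steps from a limit point in the direction of a point of `Ω'`. -/
theorem eventually_add_smul_mem {P : E × E → E} {P' : E × E →L[ℝ] E} {Ω Ω' : Set E}
    {x₀ q₀ y₀ w₀ : E} (hP : Continuous P) (hP' : HasStrictFDerivAt P P' (x₀, q₀))
    (hinj : ∀ x, Function.Injective fun y => P (x, y))
    (hconv : ∀ x ∈ Ω, Convex ℝ ((fun y => P (x, y)) '' Ω'))
    (hopen : IsOpen {z : E × E | z.2 ∈ (fun y => P (z.1, y)) '' Ω'})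
    (hx₀ : x₀ ∈ closure Ω) (hy₀ : y₀ ∈ Ω') (hw₀ : P' (0, w₀) = P (x₀, y₀) - P (x₀, q₀)) :
    ∀ᶠ r in 𝓝 (q₀, w₀, (0 : ℝ)), 0 ≤ r.2.2 → r.1 ∈ Ω' → r.1 + r.2.2 • r.2.1 ∈ Ω' := by
  set S : Set (E × E × E × ℝ) := {z | 0 < z.2.2.2}
  set e : E × E × E × ℝ → E := fun z =>
    z.2.2.2⁻¹ • (P (z.1, z.2.1 + z.2.2.2 • z.2.2.1) - P (z.1, z.2.1)) + P (z.1, z.2.1) with he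
  have htend : Tendsto e (𝓝[S] (x₀, q₀, w₀, 0)) (𝓝 (P (x₀, y₀))) := by
    have h1 : Tendsto (fun z : E × E × E × ℝ =>
        ((z.1, z.2.1 + z.2.2.2 • z.2.2.1), (z.1, z.2.1))) (𝓝[S] (x₀, q₀, w₀, 0))
        (𝓝 ((x₀, q₀), (x₀, q₀))) := by
      have : Continuous fun z : E × E × E × ℝ =>
        ((z.1, z.2.1 + z.2.2.2 • z.2.2.1), (z.1, z.2.1)) := by fun_prop
      have := this.tendsto (x₀, q₀, w₀, 0)
      simp only [zero_smul, add_zero] at this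
      exact this.mono_left nhdsWithin_le_nhds
    have h2 := hP'.isLittleO.comp_tendsto h1
    have h3 : (fun z : E × E × E × ℝ => ((0 : E), z.2.2.2 • z.2.2.1))
        =O[𝓝[S] (x₀, q₀, w₀, 0)] fun z => z.2.2.2 := by
      have h4 : Tendsto (fun z : E × E × E × ℝ => ((0 : E), z.2.2.1)) (𝓝[S] (x₀, q₀, w₀, 0))
          (𝓝 (0, w₀)) := by
        have : Continuous fun z : E × E × E × ℝ => ((0 : E), z.2.2.1) := by fun_prop
        exact (this.tendsto (x₀, q₀, w₀, 0)).mono_left nhdsWithin_le_nhds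
      have := (Asymptotics.isBigO_refl (fun z : E × E × E × ℝ => z.2.2.2)
        (𝓝[S] (x₀, q₀, w₀, 0))).smul (h4.isBigO_one ℝ)
      simpa using this
    have h5 : (fun z : E × E × E × ℝ => P (z.1, z.2.1 + z.2.2.2 • z.2.2.1) - P (z.1, z.2.1)
        - P' (0, z.2.2.2 • z.2.2.1)) =o[𝓝[S] (x₀, q₀, w₀, 0)] fun z => z.2.2.2 := by
      refine Asymptotics.IsLittleO.trans_isBigO ?_ h3
      simpa [Function.comp_def, -map_sub, ← map_sub] using h2
    have h6 := h5.tendsto_inv_smul_nhds_zero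
    have h7 : Tendsto (fun z : E × E × E × ℝ => P' (0, z.2.2.1) + P (z.1, z.2.1))
        (𝓝[S] (x₀, q₀, w₀, 0)) (𝓝 (P' (0, w₀) + P (x₀, q₀))) := by
      have : Continuous fun z : E × E × E × ℝ => P' (0, z.2.2.1) + P (z.1, z.2.1) := by fun_prop
      exact (this.tendsto (x₀, q₀, w₀, 0)).mono_left nhdsWithin_le_nhds
    have h8 := h6.add h7
    rw [hw₀, zero_add, sub_add_cancel] at h8
    refine h8.congr' ?_
    filter_upwards [self_mem_nhdsWithin] with z hz
    have hz' : z.2.2.2 ≠ 0 := ne_of_gt hz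
    have : P' (0, z.2.2.2 • z.2.2.1) = z.2.2.2 • P' (0, z.2.2.1) := by
      rw [← map_smul, Prod.smul_mk, smul_zero]
    simp only [he, this, smul_sub, inv_smul_smul₀ hz']
    abel
  have hW : ∀ᶠ z in 𝓝 (x₀, q₀, w₀, (0 : ℝ)), z ∈ S → e z ∈ (fun y => P (z.1, y)) '' Ω' := by
    rw [← eventually_nhdsWithin_iff]
    have h1 : Tendsto (fun z : E × E × E × ℝ => (z.1, e z)) (𝓝[S] (x₀, q₀, w₀, 0))
        (𝓝 (x₀, P (x₀, y₀))) :=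
      (continuousAt_fst.tendsto.mono_left nhdsWithin_le_nhds).prodMk_nhds htend
    exact h1.eventually (hopen.mem_nhds ⟨y₀, hy₀, rfl⟩)
  have hW' : ∀ᶠ x in 𝓝 x₀, ∀ᶠ r in 𝓝 (q₀, w₀, (0 : ℝ)), 0 < r.2.2 →
      e (x, r) ∈ (fun y => P (x, y)) '' Ω' := by
    rw [nhds_prod_eq] at hW
    exact hW.curry
  obtain ⟨x, hx, hxΩ⟩ := (hW'.and_frequently (mem_closure_iff_frequently.1 hx₀)).exists
  have h1 : ∀ᶠ r in 𝓝 (q₀, w₀, (0 : ℝ)), r.2.2 < 1 :=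
    (continuous_snd.snd.tendsto (q₀, w₀, (0 : ℝ))).eventually (gt_mem_nhds one_pos)
  filter_upwards [hx, h1] with r hr hr1 hr0 hrΩ
  rcases hr0.eq_or_lt with hr0 | hr0
  · simpa [← hr0] using hrΩ
  have h2 := hconv x hxΩ ⟨r.1, hrΩ, rfl⟩ (hr hr0) (sub_nonneg.2 hr1.le) hr0.le (by ring)
  obtain ⟨y, hy, hyr⟩ := h2
  have : y = r.1 + r.2.2 • r.2.1 := by
    refine hinj x (hyr.trans ?_)
    simp only [he, smul_add, smul_inv_smul₀ hr0.ne', sub_smul, one_smul]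
    abel
  exact this ▸ hy

theorem exists_depth {E : Type*} [NormedAddCommGroup E] {Ω : Set E} (hΩ : IsOpen Ω) :
    ∃ δ : E → ℝ, Continuous δ ∧ (∀ y, 0 ≤ δ y) ∧ (∀ y, 0 < δ y ↔ y ∈ Ω) ∧
      ∀ y v ε, δ y ≤ ε → (∀ y' ∈ Ω, dist y' y < ε → y' + v ∈ Ω) → δ y ≤ δ (y + v) := by
  rcases (Ωᶜ).eq_empty_or_nonempty with h | h
  · rw [compl_empty_iff] at h
    exact ⟨fun _ => 1, continuous_const, fun _ => zero_le_one, fun y => by simp [h], by simp⟩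
  have hpos : ∀ y, 0 < infDist y Ωᶜ ↔ y ∈ Ω := fun y => by
    rw [← hΩ.isClosed_compl.notMem_iff_infDist_pos h, notMem_compl_iff]
  refine ⟨fun y => infDist y Ωᶜ, continuous_infDist_pt _, fun _ => infDist_nonneg, hpos, ?_⟩
  intro y v ε hy hv
  by_contra! hlt
  obtain ⟨z, hz, hzy⟩ := (infDist_lt_iff h).1 hlt
  have hd : dist (z - v) y < infDist y Ωᶜ := by
    rwa [dist_comm, dist_eq_norm, sub_sub_eq_add_sub, ← dist_eq_norm]
  have : z - v ∈ Ω := by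
    by_contra hn
    rw [dist_comm] at hd
    exact absurd (infDist_le_dist_of_mem (mem_compl hn)) hd.not_ge
  exact hz (by simpa using hv _ this (hd.trans_le hy))

/-- A depth function does not decrease in a locally invariant direction. -/
theorem eventually_depth_le {Ω : Set E} {δ : E → ℝ} (hδ : Continuous δ)
    (hmono : ∀ y v ε, δ y ≤ ε → (∀ y' ∈ Ω, dist y' y < ε → y' + v ∈ Ω) → δ y ≤ δ (y + v))
    {q₀ w₀ : E} (hq₀ : δ q₀ = 0)
    (h : ∀ᶠ r in 𝓝 (q₀, w₀, (0 : ℝ)), 0 ≤ r.2.2 → r.1 ∈ Ω → r.1 + r.2.2 • r.2.1 ∈ Ω) :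
    ∀ᶠ r in 𝓝 (q₀, w₀, (0 : ℝ)), 0 ≤ r.2.2 → δ r.1 ≤ δ (r.1 + r.2.2 • r.2.1) := by
  rw [nhds_prod_eq] at h ⊢
  obtain ⟨p, hp, p', hp', h⟩ := eventually_prod_iff.1 h
  obtain ⟨ε, hε, hball⟩ := Metric.eventually_nhds_iff.1 hp
  have h1 : ∀ᶠ y in 𝓝 q₀, dist y q₀ < ε / 2 ∧ δ y ≤ ε / 2 :=
    (Filter.Eventually.and (ball_mem_nhds q₀ (half_pos hε))
      ((hδ.tendsto q₀).eventually (ge_mem_nhds (by rw [hq₀]; positivity))))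
  filter_upwards [h1.prod_mk hp'] with r hr hr0
  refine hmono _ _ (ε / 2) hr.1.2 fun y' hy' hd => h (hball ?_) hr.2 hr0 hy'
  linarith [dist_triangle y' r.1 q₀, hr.1.1]

end Local

section EllipticData

variable {c : (Fin n → ℝ) → (Fin n → ℝ) → ℝ} {Y : (Fin n → ℝ) → (Fin n → ℝ) → (Fin n → ℝ)}
  {Ω Ω' O : Set (Fin n → ℝ)} {u : (Fin n → ℝ) → ℝ}

/-- The data of an elliptic function `u`, of class `C²` on a neighbourhood `O` of `Ω̄`, whose
mapping `Tu` sends `Ω` onto `Ω'`. -/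
structure EllipticData (c : (Fin n → ℝ) → (Fin n → ℝ) → ℝ)
    (Y : (Fin n → ℝ) → (Fin n → ℝ) → (Fin n → ℝ)) (Ω Ω' O : Set (Fin n → ℝ))
    (u : (Fin n → ℝ) → ℝ) : Prop where
  contDiff_cost : ContDiff ℝ 2 (fun q : (Fin n → ℝ) × (Fin n → ℝ) => c q.1 q.2)
  isOpen_source : IsOpen Ω
  isOpen_target : IsOpen Ω'
  condA1 : CondA1 c Y
  condA2 : CondA2 c Ω Ω'
  convex_image : ∀ x ∈ Ω, Convex ℝ ((fun y => cxV c x y) '' Ω')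
  isOpen_nhd : IsOpen O
  closure_subset : closure Ω ⊆ O
  contDiffOn : ContDiffOn ℝ 2 u O
  elliptic : Elliptic c Y u Ω
  image_eq : Tmap Y u '' Ω = Ω'
  injOn : InjOn (Tmap Y u) (closure Ω)

theorem CondA1.injective (h : CondA1 c Y) (x : Fin n → ℝ) : Function.Injective (cxV c x) :=
  fun _ _ hy => (h.1 x _).unique hy rfl

theorem CondA1.Y_cxV (h : CondA1 c Y) (x y : Fin n → ℝ) : Y x (cxV c x y) = y :=
  h.injective x (h.2.2 x _)

/-- The pair `(x, c_x(x, y))` depends homeomorphically on `(x, y)`. -/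
theorem CondA1.continuous_uncurry (h : CondA1 c Y)
    (hc : ContDiff ℝ 2 (fun q : (Fin n → ℝ) × (Fin n → ℝ) => c q.1 q.2)) :
    Continuous fun q : (Fin n → ℝ) × (Fin n → ℝ) => Y q.1 q.2 := by
  let e : (Fin n → ℝ) × (Fin n → ℝ) ≃ (Fin n → ℝ) × (Fin n → ℝ) :=
    { toFun := fun q => (q.1, cxV c q.1 q.2)
      invFun := fun q => (q.1, Y q.1 q.2)
      left_inv := fun q => by simp [h.Y_cxV]
      right_inv := fun q => by simp [h.2.2] }
  have he : Continuous e := continuous_fst.prodMk (contDiff_cxV hc).continuous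
  exact ((e.toHomeomorphOfContinuousOpen he
    (he.isOpenMap_of_injective e.injective)).symm.continuous).snd

theorem CondA1.exists_norm_lt (h : CondA1 c Y)
    (hc : ContDiff ℝ 2 (fun q : (Fin n → ℝ) × (Fin n → ℝ) => c q.1 q.2))
    {K : Set (Fin n → ℝ)} (hK : IsCompact K) (M : ℝ) :
    ∃ R, ∀ y ∈ K, ∀ x, ‖cyV c x y‖ ≤ M → ‖x‖ < R := by
  let f : (Fin n → ℝ) × (Fin n → ℝ) → (Fin n → ℝ) × (Fin n → ℝ) := fun q => (cyV c q.1 q.2, q.2)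
  have hf : Function.Bijective f := by
    constructor
    · rintro ⟨x, y⟩ ⟨x', y'⟩ hq
      obtain ⟨h1, h2⟩ := Prod.mk.inj hq
      obtain rfl : y = y' := h2
      exact congrArg (·, y) ((h.2.1 y _).unique h1 rfl)
    · rintro ⟨q, y⟩
      obtain ⟨x, hx, -⟩ := h.2.1 y q
      exact ⟨(x, y), by simp [f, hx]⟩
  have hcont : Continuous f := (contDiff_cyV hc).continuous.prodMk continuous_snd
  let e := (Equiv.ofBijective f hf).toHomeomorphOfContinuousOpen hcont
    (hcont.isOpenMap_of_injective hf.1)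
  have hcpt : IsCompact (e.symm '' closedBall 0 M ×ˢ K) :=
    ((isCompact_closedBall 0 M).prod hK).image e.symm.continuous
  obtain ⟨R, hR⟩ := hcpt.isBounded.exists_norm_le
  refine ⟨R + 1, fun y hy x hx => ?_⟩
  have hmem : (x, y) ∈ e.symm '' closedBall 0 M ×ˢ K :=
    ⟨f (x, y), ⟨by simpa [f] using hx, hy⟩, e.symm_apply_apply (x, y)⟩
  exact ((norm_fst_le _).trans (hR _ hmem)).trans_lt (lt_add_one _)

namespace EllipticData

theorem cxV_Tmap (h : EllipticData c Y Ω Ω' O u) (x : Fin n → ℝ) :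
    cxV c x (Tmap Y u x) = gradv u x :=
  h.condA1.2.2 x _

theorem continuous_cxV (h : EllipticData c Y Ω Ω' O u) :
    Continuous fun q : (Fin n → ℝ) × (Fin n → ℝ) => cxV c q.1 q.2 :=
  (contDiff_cxV h.contDiff_cost).continuous

theorem contDiffOn_gradv (h : EllipticData c Y Ω Ω' O u) : ContDiffOn ℝ 1 (gradv u) O :=
  _root_.contDiffOn_gradv h.isOpen_nhd h.contDiffOn

theorem mem_nhds (h : EllipticData c Y Ω Ω' O u) {x : Fin n → ℝ} (hx : x ∈ closure Ω) :
    O ∈ 𝓝 x :=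
  h.isOpen_nhd.mem_nhds (h.closure_subset hx)

theorem hasStrictFDerivAt_gradv (h : EllipticData c Y Ω Ω' O u) {x : Fin n → ℝ}
    (hx : x ∈ closure Ω) : HasStrictFDerivAt (gradv u) (fderiv ℝ (gradv u) x) x :=
  (h.contDiffOn_gradv.contDiffAt (h.mem_nhds hx)).hasStrictFDerivAt one_ne_zero

theorem continuousOn_Tmap (h : EllipticData c Y Ω Ω' O u) : ContinuousOn (Tmap Y u) O :=
  (h.condA1.continuous_uncurry h.contDiff_cost).comp_continuousOn
    (continuousOn_id.prodMk h.contDiffOn_gradv.continuousOn)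

theorem continuousAt_Tmap (h : EllipticData c Y Ω Ω' O u) {x : Fin n → ℝ}
    (hx : x ∈ closure Ω) : ContinuousAt (Tmap Y u) x :=
  h.continuousOn_Tmap.continuousAt (h.mem_nhds hx)

theorem Tmap_mem (h : EllipticData c Y Ω Ω' O u) {x : Fin n → ℝ} (hx : x ∈ Ω) :
    Tmap Y u x ∈ Ω' :=
  h.image_eq ▸ mem_image_of_mem _ hx

theorem Tmap_mem_closure (h : EllipticData c Y Ω Ω' O u) {x : Fin n → ℝ} (hx : x ∈ closure Ω) :
    Tmap Y u x ∈ closure Ω' :=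
  h.image_eq ▸ mem_closure_image (h.continuousAt_Tmap hx) hx

theorem Tmap_mem_iff (h : EllipticData c Y Ω Ω' O u) {x : Fin n → ℝ} (hx : x ∈ closure Ω) :
    Tmap Y u x ∈ Ω' ↔ x ∈ Ω := by
  refine ⟨fun hT => ?_, h.Tmap_mem⟩
  rw [← h.image_eq] at hT
  obtain ⟨x', hx', hxx'⟩ := hT
  exact h.injOn (subset_closure hx') hx hxx' ▸ hx'

theorem det_ne_zero (h : EllipticData c Y Ω Ω' O u) {x : Fin n → ℝ} (hx : x ∈ closure Ω) :
    (cxyM c x (Tmap Y u x)).det ≠ 0 :=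
  h.condA2 x hx _ (h.Tmap_mem_closure hx)

theorem isOpen_setOf_mem_image (h : EllipticData c Y Ω Ω' O u) :
    IsOpen {z : (Fin n → ℝ) × (Fin n → ℝ) | z.2 ∈ (fun y => cxV c z.1 y) '' Ω'} := by
  convert h.isOpen_target.preimage (h.condA1.continuous_uncurry h.contDiff_cost) using 1
  ext z
  constructor
  · rintro ⟨y, hy, hyz⟩
    simpa [← hyz, h.condA1.Y_cxV] using hy
  · exact fun hz => ⟨_, hz, h.condA1.2.2 _ _⟩

/-- The invertible operator `c_{x,y}(x, Tu(x))`. -/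
theorem exists_equiv_cxVDeriv (h : EllipticData c Y Ω Ω' O u) {x : Fin n → ℝ}
    (hx : x ∈ closure Ω) : ∃ A : (Fin n → ℝ) ≃L[ℝ] (Fin n → ℝ),
      (A : (Fin n → ℝ) →L[ℝ] (Fin n → ℝ))
        = (cxVDeriv c x (Tmap Y u x)).comp (ContinuousLinearMap.inr ℝ _ _) := by
  let L := (cxVDeriv c x (Tmap Y u x)).comp (ContinuousLinearMap.inr ℝ (Fin n → ℝ) (Fin n → ℝ))
  have hL : Function.Injective (L : (Fin n → ℝ) →ₗ[ℝ] (Fin n → ℝ)) :=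
    (injective_iff_map_eq_zero _).2 fun v hv =>
      cxVDeriv_injective h.contDiff_cost (h.det_ne_zero hx) hv
  exact ⟨(LinearEquiv.ofInjectiveEndo _ hL).toContinuousLinearEquiv, by ext v; rfl⟩

theorem dotProduct_pos (h : EllipticData c Y Ω Ω' O u) {x : Fin n → ℝ} (hx : x ∈ Ω)
    {v : Fin n → ℝ} (hv : v ≠ 0) :
    0 < (fderiv ℝ (gradv u) x v - cxVDeriv c x (Tmap Y u x) (v, 0)) ⬝ᵥ v :=
  h.elliptic.dotProduct_pos h.contDiff_cost hx
    (h.hasStrictFDerivAt_gradv (subset_closure hx)).hasFDerivAt.differentiableAt hv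

theorem exists_hasStrictFDerivAt_Tmap (h : EllipticData c Y Ω Ω' O u) {x : Fin n → ℝ}
    (hx : x ∈ Ω) : ∃ D : (Fin n → ℝ) ≃L[ℝ] (Fin n → ℝ),
      HasStrictFDerivAt (Tmap Y u) (D : (Fin n → ℝ) →L[ℝ] (Fin n → ℝ)) x ∧
      ∀ v, cxVDeriv c x (Tmap Y u x) (0, D v)
        = fderiv ℝ (gradv u) x v - cxVDeriv c x (Tmap Y u x) (v, 0) := by
  have hx' := subset_closure hx
  set P' := cxVDeriv c x (Tmap Y u x)
  have hP := hasStrictFDerivAt_cxV h.contDiff_cost x (Tmap Y u x)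
  let L : (Fin n → ℝ) × (Fin n → ℝ) →L[ℝ] (Fin n → ℝ) × (Fin n → ℝ) :=
    (ContinuousLinearMap.fst ℝ _ _).prod P'
  have hL : Function.Injective (L : (Fin n → ℝ) × (Fin n → ℝ) →ₗ[ℝ] (Fin n → ℝ) × (Fin n → ℝ)) := by
    refine (injective_iff_map_eq_zero _).2 fun v hv => ?_
    obtain ⟨v₁, v₂⟩ := v
    obtain ⟨h1, h2⟩ := Prod.mk.inj hv
    obtain rfl : v₁ = 0 := h1
    rw [cxVDeriv_injective h.contDiff_cost (h.det_ne_zero hx') h2]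
    rfl
  let e := (LinearEquiv.ofInjectiveEndo _ hL).toContinuousLinearEquiv
  have he : (e : (Fin n → ℝ) × (Fin n → ℝ) →L[ℝ] (Fin n → ℝ) × (Fin n → ℝ)) = L := by
    ext v <;> rfl
  have hf : HasStrictFDerivAt (fun q : (Fin n → ℝ) × (Fin n → ℝ) => (q.1, cxV c q.1 q.2))
      (e : (Fin n → ℝ) × (Fin n → ℝ) →L[ℝ] (Fin n → ℝ) × (Fin n → ℝ)) (x, Tmap Y u x) := by
    rw [he]
    exact hasStrictFDerivAt_fst.prodMk hP
  have hY : HasStrictFDerivAt (fun q : (Fin n → ℝ) × (Fin n → ℝ) => (q.1, Y q.1 q.2))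
      (e.symm : (Fin n → ℝ) × (Fin n → ℝ) →L[ℝ] (Fin n → ℝ) × (Fin n → ℝ)) (x, gradv u x) :=
    HasStrictFDerivAt.of_local_left_inverse
      (continuous_fst.prodMk (h.condA1.continuous_uncurry h.contDiff_cost)).continuousAt hf
      (Eventually.of_forall fun q => by simp [h.condA1.2.2])
  obtain ⟨D', hT⟩ : ∃ D', HasStrictFDerivAt (Tmap Y u) D' x :=
    ⟨_, hY.snd.comp (f := fun z => (z, gradv u z)) x
      ((hasStrictFDerivAt_id x).prodMk (h.hasStrictFDerivAt_gradv hx'))⟩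
  have hD : ∀ v, P' (0, D' v) = fderiv ℝ (gradv u) x v - P' (v, 0) := by
    intro v
    have h1 : HasStrictFDerivAt (gradv u)
        (P'.comp ((ContinuousLinearMap.id ℝ (Fin n → ℝ)).prod D')) x := by
      have h2 := hP.comp (f := fun z => (z, Tmap Y u z)) x ((hasStrictFDerivAt_id x).prodMk hT)
      refine h2.congr_of_eventuallyEq (Eventually.of_forall fun z => ?_)
      exact h.cxV_Tmap z
    rw [h1.hasFDerivAt.fderiv, eq_sub_iff_add_eq, ← map_add]
    simp
  have hinj : Function.Injective (D' : (Fin n → ℝ) →ₗ[ℝ] (Fin n → ℝ)) := by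
    refine (injective_iff_map_eq_zero _).2 fun v hv => ?_
    by_contra hv0
    have h1 := h.dotProduct_pos hx hv0
    rw [← hD v, show D' v = 0 from hv, Prod.mk_zero_zero, map_zero, zero_dotProduct] at h1
    exact h1.false
  have hcoe : ((LinearEquiv.ofInjectiveEndo _ hinj).toContinuousLinearEquiv :
      (Fin n → ℝ) →L[ℝ] (Fin n → ℝ)) = D' := by
    ext v
    rfl
  exact ⟨(LinearEquiv.ofInjectiveEndo _ hinj).toContinuousLinearEquiv, by rw [hcoe]; exact hT, hD⟩

/-- The inverse of `Tu` on `Ω'`. -/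
theorem exists_inverse (h : EllipticData c Y Ω Ω' O u) :
    ∃ X : (Fin n → ℝ) → (Fin n → ℝ), ContinuousOn X Ω' ∧ (∀ y ∈ Ω', X y ∈ Ω) ∧
      (∀ y ∈ Ω', Tmap Y u (X y) = y) ∧ ∀ x ∈ Ω, X (Tmap Y u x) = x := by
  have hinj : InjOn (Tmap Y u) Ω := h.injOn.mono subset_closure
  have hmem : ∀ y ∈ Ω', ∃ x ∈ Ω, Tmap Y u x = y := fun y hy => by rwa [← h.image_eq] at hy
  choose! X hXΩ hTX using hmem
  have hXT : ∀ x ∈ Ω, X (Tmap Y u x) = x := fun x hx =>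
    hinj (hXΩ _ (h.Tmap_mem hx)) hx (hTX _ (h.Tmap_mem hx))
  refine ⟨X, fun y hy => ContinuousAt.continuousWithinAt ?_, hXΩ, hTX, hXT⟩
  obtain ⟨D, hD, -⟩ := h.exists_hasStrictFDerivAt_Tmap (hXΩ y hy)
  have hmap := hD.map_nhds_eq_of_equiv
  rw [hTX y hy] at hmap
  rw [ContinuousAt, ← hmap, tendsto_map'_iff]
  refine tendsto_id.congr' ?_
  filter_upwards [h.isOpen_source.mem_nhds (hXΩ y hy)] with x hx
  exact (hXT x hx).symm

end EllipticData
end EllipticData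

section Coercive

theorem abs_dotProduct_le (a b : Fin n → ℝ) : |a ⬝ᵥ b| ≤ n * (‖a‖ * ‖b‖) := by
  calc |a ⬝ᵥ b| ≤ ∑ i, |a i * b i| := Finset.abs_sum_le_sum_abs _ _
    _ ≤ ∑ _i : Fin n, ‖a‖ * ‖b‖ := Finset.sum_le_sum fun i _ => by
        rw [abs_mul]
        exact mul_le_mul (norm_le_pi_norm a i) (norm_le_pi_norm b i) (abs_nonneg _) (norm_nonneg _)
    _ = n * (‖a‖ * ‖b‖) := by simp

theorem HasFDerivAt.eventually_dotProduct_pos {G : (Fin n → ℝ) → (Fin n → ℝ)}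
    {B : (Fin n → ℝ) →L[ℝ] (Fin n → ℝ)} {x₀ : Fin n → ℝ} (hG : HasFDerivAt G B x₀)
    (hG₀ : G x₀ = 0) (hB : ∀ v, v ≠ 0 → 0 < B v ⬝ᵥ v) :
    ∀ᶠ x in 𝓝 x₀, x ≠ x₀ → 0 < G x ⬝ᵥ (x - x₀) := by
  have hcont : Continuous fun v : Fin n → ℝ => B v ⬝ᵥ v := by
    unfold dotProduct
    fun_prop
  obtain ⟨κ, hκ, hκB⟩ := (isCompact_sphere (0 : Fin n → ℝ) 1).exists_forall_le' (a := 0)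
    hcont.continuousOn fun v hv => hB v (ne_of_mem_sphere hv one_ne_zero)
  have hlow : ∀ v, κ * ‖v‖ ^ 2 ≤ B v ⬝ᵥ v := by
    intro v
    rcases eq_or_ne v 0 with rfl | hv
    · simp
    have hv' : ‖v‖ ≠ 0 := norm_ne_zero_iff.2 hv
    have h1 := hκB (‖v‖⁻¹ • v) (by simp [norm_smul, hv'])
    rw [map_smul, smul_dotProduct, dotProduct_smul, smul_eq_mul, smul_eq_mul, ← mul_assoc,
      ← sq, inv_pow, ← div_eq_inv_mul, le_div_iff₀ (by positivity)] at h1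
    exact h1
  have hη : 0 < κ / (n + 1) := by positivity
  filter_upwards [hG.isLittleO.def hη] with x hx hne
  rw [hG₀, sub_zero] at hx
  have hpos : 0 < ‖x - x₀‖ := norm_pos_iff.2 (sub_ne_zero.2 hne)
  have h1 : G x ⬝ᵥ (x - x₀)
      = B (x - x₀) ⬝ᵥ (x - x₀) + (G x - B (x - x₀)) ⬝ᵥ (x - x₀) := by
    rw [sub_dotProduct]; ring
  have h2 := (abs_le.1 (abs_dotProduct_le (G x - B (x - x₀)) (x - x₀))).1
  have h3 : (n : ℝ) * (‖G x - B (x - x₀)‖ * ‖x - x₀‖)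
      ≤ n * (κ / (n + 1) * ‖x - x₀‖ * ‖x - x₀‖) := by gcongr
  have h4 : (n : ℝ) * (κ / (n + 1) * ‖x - x₀‖ * ‖x - x₀‖) < κ * ‖x - x₀‖ ^ 2 := by
    have : (n : ℝ) * (κ / (n + 1)) < κ := by
      rw [mul_div_assoc', div_lt_iff₀ (by positivity)]
      nlinarith
    nlinarith [mul_pos hpos hpos]
  linarith [hlow (x - x₀)]

end Coercive

section Slope

variable {E : Type*} [NormedAddCommGroup E] [NormedSpace ℝ E]

theorem HasStrictFDerivAt.eventually_of_add_smul {T : E → E} {D : E →L[ℝ] E} {x V : E}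
    (hT : HasStrictFDerivAt T D x) {δ : E → ℝ}
    (h : ∀ᶠ r in 𝓝 (T x, D V, (0 : ℝ)), 0 ≤ r.2.2 → δ r.1 ≤ δ (r.1 + r.2.2 • r.2.1)) :
    ∀ᶠ p in 𝓝 (x, (0 : ℝ)), 0 ≤ p.2 → δ (T p.1) ≤ δ (T (p.1 + p.2 • V)) := by
  set S : Set (E × ℝ) := {p | 0 < p.2}
  have h1 : Tendsto (fun p : E × ℝ => (p.1 + p.2 • V, p.1)) (𝓝[S] (x, 0)) (𝓝 (x, x)) := by
    have : Continuous fun p : E × ℝ => (p.1 + p.2 • V, p.1) := by fun_prop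
    have := this.tendsto (x, 0)
    simp only [zero_smul, add_zero] at this
    exact this.mono_left nhdsWithin_le_nhds
  have h2 := hT.isLittleO.comp_tendsto h1
  have h3 : (fun p : E × ℝ => T (p.1 + p.2 • V) - T p.1 - p.2 • D V)
      =o[𝓝[S] (x, 0)] fun p => p.2 := by
    have h4 : (fun p : E × ℝ => p.2 • V) =O[𝓝[S] (x, 0)] fun p => p.2 := by
      simpa using (Asymptotics.isBigO_refl (fun p : E × ℝ => p.2) (𝓝[S] (x, 0))).smul
        (Asymptotics.isBigO_const_const V (one_ne_zero (α := ℝ)) _)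
    refine Asymptotics.IsLittleO.trans_isBigO ?_ h4
    simpa [Function.comp_def] using h2
  have h5 : Tendsto (fun p : E × ℝ => p.2⁻¹ • (T (p.1 + p.2 • V) - T p.1)) (𝓝[S] (x, 0))
      (𝓝 (D V)) := by
    have h6 := h3.tendsto_inv_smul_nhds_zero.add_const (D V)
    rw [zero_add] at h6
    refine h6.congr' ?_
    filter_upwards [self_mem_nhdsWithin] with p hp
    rw [smul_sub, inv_smul_smul₀ (ne_of_gt hp), sub_add_cancel]
  have h7 : Tendsto (fun p : E × ℝ => (T p.1, p.2⁻¹ • (T (p.1 + p.2 • V) - T p.1), p.2))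
      (𝓝[S] (x, 0)) (𝓝 (T x, D V, 0)) :=
    ((hT.hasFDerivAt.continuousAt.tendsto.comp (continuous_fst.tendsto (x, (0 : ℝ)))).mono_left
      nhdsWithin_le_nhds).prodMk_nhds
      (h5.prodMk_nhds ((continuous_snd.tendsto (x, (0 : ℝ))).mono_left nhdsWithin_le_nhds))
  have h8 := eventually_nhdsWithin_iff.1 (h7.eventually h)
  filter_upwards [h8] with p hp hp0
  rcases hp0.eq_or_lt with hp0 | hp0
  · simp [← hp0]
  have := hp hp0 hp0.le
  simpa [smul_inv_smul₀ hp0.ne'] using this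

end Slope

namespace EllipticData

variable {c : (Fin n → ℝ) → (Fin n → ℝ) → ℝ} {Y : (Fin n → ℝ) → (Fin n → ℝ) → (Fin n → ℝ)}
  {Ω Ω' O : Set (Fin n → ℝ)} {u : (Fin n → ℝ) → ℝ} {δ : (Fin n → ℝ) → ℝ}

/-- The depth does not decrease near `Tu(x)` when moving along a direction `w` that points from
`c_x(x, Tu(x))` to `c_x(x, y)`. -/
def DepthGrows (c : (Fin n → ℝ) → (Fin n → ℝ) → ℝ)
    (Y : (Fin n → ℝ) → (Fin n → ℝ) → (Fin n → ℝ)) (u : (Fin n → ℝ) → ℝ) (δ : (Fin n → ℝ) → ℝ)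
    (x y : Fin n → ℝ) : Prop :=
  ∀ w, cxVDeriv c x (Tmap Y u x) (0, w) = cxV c x y - cxV c x (Tmap Y u x) →
    ∀ᶠ r in 𝓝 (Tmap Y u x, w, (0 : ℝ)), 0 ≤ r.2.2 → δ r.1 ≤ δ (r.1 + r.2.2 • r.2.1)

theorem eventually_depthGrows (h : EllipticData c Y Ω Ω' O u) (hδ : Continuous δ)
    (hδ0 : ∀ y, 0 ≤ δ y) (hδpos : ∀ y, 0 < δ y ↔ y ∈ Ω')
    (hmono : ∀ y v ε, δ y ≤ ε → (∀ y' ∈ Ω', dist y' y < ε → y' + v ∈ Ω') → δ y ≤ δ (y + v))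
    {x₀ y₀ : Fin n → ℝ} (hx₀ : x₀ ∈ closure Ω) (hx₀' : x₀ ∉ Ω) (hy₀ : y₀ ∈ Ω') :
    ∀ᶠ z in 𝓝 (x₀, y₀), z.1 ∈ closure Ω → DepthGrows c Y u δ z.1 z.2 := by
  let A : (Fin n → ℝ) → (Fin n → ℝ) →L[ℝ] (Fin n → ℝ) := fun x =>
    (cxVDeriv c x (Tmap Y u x)).comp (ContinuousLinearMap.inr ℝ _ _)
  let W : (Fin n → ℝ) × (Fin n → ℝ) → (Fin n → ℝ) := fun z =>
    (A z.1).inverse (cxV c z.1 z.2 - cxV c z.1 (Tmap Y u z.1))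
  have hW : ∀ z : (Fin n → ℝ) × (Fin n → ℝ), z.1 ∈ closure Ω → ∀ w,
      A z.1 w = cxV c z.1 z.2 - cxV c z.1 (Tmap Y u z.1) ↔ w = W z := by
    intro z hz w
    obtain ⟨e, he⟩ := h.exists_equiv_cxVDeriv hz
    have he' : A z.1 = e := he.symm
    simp only [W, he', ContinuousLinearMap.inverse_equiv]
    exact (e.eq_symm_apply).symm
  have hT := h.continuousAt_Tmap hx₀
  have hAc : ContinuousAt A x₀ := by
    have h1 : Continuous (fun q : (Fin n → ℝ) × (Fin n → ℝ) => cxVDeriv c q.1 q.2) :=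
      (contDiff_cxV h.contDiff_cost).continuous_fderiv one_ne_zero
    have h2 : ContinuousAt (fun x => cxVDeriv c x (Tmap Y u x)) x₀ :=
      h1.continuousAt.comp (f := fun x => (x, Tmap Y u x)) (continuousAt_id.prodMk hT)
    exact h2.clm_comp continuousAt_const
  have hAinv : ContinuousAt (fun x => (A x).inverse) x₀ := by
    obtain ⟨e, he⟩ := h.exists_equiv_cxVDeriv hx₀
    have he' : A x₀ = e := he.symm
    refine ContinuousAt.comp (g := ContinuousLinearMap.inverse) ?_ hAc
    rw [he']
    exact (contDiffAt_map_inverse (n := 0) e).continuousAt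
  have hTz : ContinuousAt (fun z : (Fin n → ℝ) × (Fin n → ℝ) => Tmap Y u z.1) (x₀, y₀) :=
    hT.comp (f := Prod.fst) (x := (x₀, y₀)) continuousAt_fst
  have hWc : ContinuousAt W (x₀, y₀) := by
    have h1 : ContinuousAt (fun z : (Fin n → ℝ) × (Fin n → ℝ) => (A z.1).inverse) (x₀, y₀) :=
      ContinuousAt.comp (f := Prod.fst) (x := (x₀, y₀)) hAinv continuousAt_fst
    refine h1.clm_apply (h.continuous_cxV.continuousAt.sub ?_)
    exact h.continuous_cxV.continuousAt.comp
      (f := fun z : (Fin n → ℝ) × (Fin n → ℝ) => (z.1, Tmap Y u z.1)) (continuousAt_fst.prodMk hTz)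
  have hq₀ : δ (Tmap Y u x₀) = 0 :=
    le_antisymm (not_lt.1 fun hp => hx₀' ((h.Tmap_mem_iff hx₀).1 ((hδpos _).1 hp))) (hδ0 _)
  have h1 := eventually_depth_le hδ hmono hq₀ (eventually_add_smul_mem (w₀ := W (x₀, y₀))
    h.continuous_cxV (hasStrictFDerivAt_cxV h.contDiff_cost x₀ (Tmap Y u x₀))
    h.condA1.injective h.convex_image h.isOpen_setOf_mem_image hx₀ hy₀
    ((hW (x₀, y₀) hx₀ _).2 rfl))
  have h2 : Tendsto (fun z => (Tmap Y u z.1, W z, (0 : ℝ))) (𝓝 (x₀, y₀))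
      (𝓝 (Tmap Y u x₀, W (x₀, y₀), 0)) :=
    hTz.tendsto.prodMk_nhds (hWc.tendsto.prodMk_nhds tendsto_const_nhds)
  filter_upwards [h2.eventually (eventually_eventually_nhds.2 h1)] with z hz hzΩ w hw
  rw [(hW z hzΩ w).1 hw]
  exact hz

theorem exists_forall_depthGrows (h : EllipticData c Y Ω Ω' O u) (hδ : Continuous δ)
    (hδ0 : ∀ y, 0 ≤ δ y) (hδpos : ∀ y, 0 < δ y ↔ y ∈ Ω')
    (hmono : ∀ y v ε, δ y ≤ ε → (∀ y' ∈ Ω', dist y' y < ε → y' + v ∈ Ω') → δ y ≤ δ (y + v))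
    {K Z : Set (Fin n → ℝ)} (hK : IsCompact K) (hKΩ : K ⊆ closure Ω) (hZ : IsCompact Z)
    (hZΩ : Z ⊆ Ω') :
    ∃ s > 0, ∀ x ∈ K, ∀ y ∈ Z, δ (Tmap Y u x) < s → DepthGrows c Y u δ x y := by
  set G : Set ((Fin n → ℝ) × (Fin n → ℝ)) :=
    {z | z.1 ∈ closure Ω → DepthGrows c Y u δ z.1 z.2}
  have hB : IsCompact ((K ×ˢ Z) \ interior G) := (hK.prod hZ).diff isOpen_interior
  have hcont : ContinuousOn (fun z : (Fin n → ℝ) × (Fin n → ℝ) => δ (Tmap Y u z.1))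
      ((K ×ˢ Z) \ interior G) :=
    hδ.comp_continuousOn (h.continuousOn_Tmap.comp continuousOn_fst fun z hz =>
      h.closure_subset (hKΩ hz.1.1))
  obtain ⟨s, hs, hsB⟩ := hB.exists_forall_le' (a := 0) hcont fun z hz => by
    by_contra hn
    refine hz.2 (mem_interior_iff_mem_nhds.2 ?_)
    refine h.eventually_depthGrows hδ hδ0 hδpos hmono (hKΩ hz.1.1) (fun hzΩ => ?_) (hZΩ hz.1.2)
    exact hn ((hδpos _).2 (h.Tmap_mem hzΩ))
  refine ⟨s, hs, fun x hx y hy hxs => ?_⟩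
  by_contra hn
  refine (hsB (x, y) ⟨⟨hx, hy⟩, fun hi => hn (interior_subset hi (hKΩ hx))⟩).not_gt hxs

end EllipticData

section Penalty

/-- A function of the depth that blows up at `0` and vanishes from `s₀` on. -/
def depthPenalty (s₀ s : ℝ) : ℝ := max 0 (s⁻¹ - s₀⁻¹)

theorem depthPenalty_nonneg (s₀ s : ℝ) : 0 ≤ depthPenalty s₀ s := le_max_left _ _

theorem depthPenalty_eq_zero {s₀ s : ℝ} (hs₀ : 0 < s₀) (h : s₀ ≤ s) : depthPenalty s₀ s = 0 :=
  max_eq_left (sub_nonpos.2 (inv_anti₀ hs₀ h))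

theorem depthPenalty_anti {s₀ s t : ℝ} (hs : 0 < s) (h : s ≤ t) :
    depthPenalty s₀ t ≤ depthPenalty s₀ s :=
  max_le_max_left 0 (sub_le_sub_right (inv_anti₀ hs h) _)

theorem continuousOn_depthPenalty (s₀ : ℝ) : ContinuousOn (depthPenalty s₀) (Ioi 0) :=
  ContinuousOn.sup continuousOn_const ((continuousOn_inv₀.mono fun _ hs => ne_of_gt hs).sub continuousOn_const)

theorem inv_le_of_depthPenalty_le {s₀ s a : ℝ} (hs : 0 < s)
    (h : depthPenalty s₀ s ≤ a) : (a + s₀⁻¹)⁻¹ ≤ s :=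
  inv_le_of_inv_le₀ hs (by linarith [(le_max_right _ _).trans h])

end Penalty

namespace EllipticData

variable {c : (Fin n → ℝ) → (Fin n → ℝ) → ℝ} {Y : (Fin n → ℝ) → (Fin n → ℝ) → (Fin n → ℝ)}
  {Ω Ω' O : Set (Fin n → ℝ)} {u : (Fin n → ℝ) → ℝ} {δ : (Fin n → ℝ) → ℝ} {s₀ : ℝ}

/-- The function `u - c(·, y)`, penalized near the boundary of `Ω`. -/
def penalized (c : (Fin n → ℝ) → (Fin n → ℝ) → ℝ)
    (Y : (Fin n → ℝ) → (Fin n → ℝ) → (Fin n → ℝ)) (u : (Fin n → ℝ) → ℝ) (δ : (Fin n → ℝ) → ℝ)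
    (s₀ : ℝ) (x y : Fin n → ℝ) : ℝ :=
  u x - c x y + depthPenalty s₀ (δ (Tmap Y u x))

theorem hasStrictFDerivAt_sub (h : EllipticData c Y Ω Ω' O u) {x : Fin n → ℝ}
    (hx : x ∈ closure Ω) (y : Fin n → ℝ) : ∃ L : (Fin n → ℝ) →L[ℝ] ℝ,
      HasStrictFDerivAt (fun z => u z - c z y) L x ∧ ∀ v, L v = (gradv u x - cxV c x y) ⬝ᵥ v := by
  have h1 : ContDiffAt ℝ 2 u x := h.contDiffOn.contDiffAt (h.mem_nhds hx)
  have h2 : ContDiff ℝ 2 fun z => c z y :=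
    h.contDiff_cost.comp (g := fun q : (Fin n → ℝ) × (Fin n → ℝ) => c q.1 q.2)
      (contDiff_id.prodMk contDiff_const)
  refine ⟨_, (h1.hasStrictFDerivAt two_ne_zero).sub
    (h2.contDiffAt.hasStrictFDerivAt two_ne_zero), fun v => ?_⟩
  rw [sub_apply, fderiv_eq_gradv_dotProduct, fderiv_eq_gradv_dotProduct, sub_dotProduct]
  rfl

theorem continuousOn_sub (h : EllipticData c Y Ω Ω' O u) :
    ContinuousOn (fun q : (Fin n → ℝ) × (Fin n → ℝ) => u q.1 - c q.1 q.2) (O ×ˢ univ) :=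
  (h.contDiffOn.continuousOn.comp continuousOn_fst fun _ hq => hq.1).sub
    h.contDiff_cost.continuous.continuousOn

theorem continuousOn_penalized (h : EllipticData c Y Ω Ω' O u) (hδ : Continuous δ)
    (hδpos : ∀ y, 0 < δ y ↔ y ∈ Ω') :
    ContinuousOn (Function.uncurry (penalized c Y u δ s₀)) (Ω ×ˢ univ) := by
  have hsub : Ω ⊆ O := subset_closure.trans h.closure_subset
  refine (h.continuousOn_sub.mono (prod_mono_left hsub)).add
    ((continuousOn_depthPenalty s₀).comp ?_ fun q hq => (hδpos _).2 (h.Tmap_mem hq.1))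
  exact hδ.comp_continuousOn
    ((h.continuousOn_Tmap.mono hsub).comp continuousOn_fst fun _ hq => hq.1)

theorem hasDescent_penalized (h : EllipticData c Y Ω Ω' O u) (hδ : Continuous δ)
    (hδpos : ∀ y, 0 < δ y ↔ y ∈ Ω') (hs₀ : 0 < s₀) {x y : Fin n → ℝ} (hx : x ∈ Ω)
    (hne : Tmap Y u x ≠ y) (hgrow : s₀ < δ (Tmap Y u x) ∨ DepthGrows c Y u δ x y) :
    HasDescent (penalized c Y u δ s₀) x y := by
  have hx' := subset_closure hx
  obtain ⟨A, hA⟩ := h.exists_equiv_cxVDeriv hx'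
  have hA' : ∀ w, A w = cxVDeriv c x (Tmap Y u x) (0, w) := DFunLike.congr_fun hA
  obtain ⟨D, hD, hDB⟩ := h.exists_hasStrictFDerivAt_Tmap hx
  set w := A.symm (cxV c x y - cxV c x (Tmap Y u x))
  have hw : cxVDeriv c x (Tmap Y u x) (0, w) = cxV c x y - cxV c x (Tmap Y u x) := by
    rw [← hA', A.apply_symm_apply]
  set V := D.symm w
  have hDV : D V = w := D.apply_symm_apply w
  have hV : V ≠ 0 := fun h0 => by
    have hw0 : w = 0 := by rw [← hDV, h0, map_zero]
    rw [hw0, Prod.mk_zero_zero, map_zero] at hw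
    exact hne (h.condA1.injective x (sub_eq_zero.1 hw.symm).symm)
  have hpos := h.dotProduct_pos hx hV
  rw [← hDB, hDV, hw, h.cxV_Tmap] at hpos
  obtain ⟨L, hL, hLv⟩ := h.hasStrictFDerivAt_sub hx' y
  set a := (cxV c x y - gradv u x) ⬝ᵥ V
  have hLV : L V < -(a / 2) := by
    have : L V = -a := by rw [hLv, ← neg_sub, neg_dotProduct]
    linarith
  refine HasDescent.of_eventually (V := V) (half_pos hpos) ?_
  have hT : ContinuousAt (Tmap Y u) x := h.continuousAt_Tmap hx'
  have h1 : Tendsto (fun p : (Fin n → ℝ) × ℝ => p.1 + p.2 • V) (𝓝 (x, 0)) (𝓝 x) := by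
    have : Continuous fun p : (Fin n → ℝ) × ℝ => p.1 + p.2 • V := by fun_prop
    simpa using this.tendsto (x, 0)
  have h2 : ∀ᶠ p in 𝓝 (x, (0 : ℝ)), 0 ≤ p.2 →
      depthPenalty s₀ (δ (Tmap Y u (p.1 + p.2 • V))) ≤ depthPenalty s₀ (δ (Tmap Y u p.1)) := by
    rcases hgrow with hs | hs
    · have h3 : ∀ᶠ z in 𝓝 x, s₀ < δ (Tmap Y u z) :=
        (hδ.continuousAt.comp hT).eventually (lt_mem_nhds hs)
      filter_upwards [h1.eventually h3] with p hp _
      rw [depthPenalty_eq_zero hs₀ hp.le]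
      exact depthPenalty_nonneg _ _
    · have h3 : ∀ᶠ z in 𝓝 x, 0 < δ (Tmap Y u z) :=
        (hδ.continuousAt.comp hT).eventually (lt_mem_nhds ((hδpos _).2 (h.Tmap_mem hx)))
      have h4 := hD.eventually_of_add_smul (δ := δ) (V := V) (by
        rw [ContinuousLinearEquiv.coe_coe, hDV]; exact hs w hw)
      filter_upwards [(continuous_fst.tendsto (x, (0 : ℝ))).eventually h3, h4] with p hp hp4 hp0
      exact depthPenalty_anti hp (hp4 hp0)
  filter_upwards [hL.eventually_add_smul_le hLV, h2] with p hp1 hp2 hp0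
  have := hp1 hp0
  have := hp2 hp0
  unfold penalized
  linarith

theorem hasBarrier_penalized (h : EllipticData c Y Ω Ω' O u) {U : Set (Fin n → ℝ)}
    (hU : IsOpen U) (hUΩ : U ⊆ Ω) (hs₀ : 0 < s₀) {x y : Fin n → ℝ} (hx : x ∈ U)
    (hxy : Tmap Y u x = y) (hy : s₀ ≤ δ y) : HasBarrier (penalized c Y u δ s₀) U x y := by
  subst hxy
  have hxΩ := hUΩ hx
  have hx' := subset_closure hxΩ
  have hG : HasFDerivAt (fun z => gradv u z - cxV c z (Tmap Y u x))
      (fderiv ℝ (gradv u) x - (cxVDeriv c x (Tmap Y u x)).comp (ContinuousLinearMap.inl ℝ _ _))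
      x :=
    (h.hasStrictFDerivAt_gradv hx').hasFDerivAt.sub
      ((hasStrictFDerivAt_cxV h.contDiff_cost x _).hasFDerivAt.comp
        (f := fun z => (z, Tmap Y u x)) x (hasFDerivAt_prodMk_left x _))
  have hpos := hG.eventually_dotProduct_pos (sub_eq_zero.2 (h.cxV_Tmap x).symm)
    fun v hv => h.dotProduct_pos hxΩ hv
  obtain ⟨ε, hε, hball⟩ := nhds_basis_closedBall.eventually_iff.1
    (hpos.and (hU.mem_nhds hx))
  refine ⟨closedBall x ε, isCompact_closedBall x ε, fun z hz => (hball hz).2,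
    mem_closedBall_self hε.le, fun z hz => ?_⟩
  have hz' : z ∈ closedBall x ε := isClosed_closedBall.frontier_subset hz
  have hzx : z ≠ x := by
    rintro rfl
    exact hz.2 (ball_subset_interior_closedBall (mem_ball_self hε))
  set ψ : ℝ → ℝ := fun t => u (x + t • (z - x)) - c (x + t • (z - x)) (Tmap Y u x)
  have hmem : ∀ t ∈ Icc (0 : ℝ) 1, x + t • (z - x) ∈ closedBall x ε := by
    intro t ht
    rw [mem_closedBall, dist_eq_norm] at hz' ⊢
    rw [add_sub_cancel_left, norm_smul, Real.norm_eq_abs, abs_of_nonneg ht.1]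
    exact (mul_le_of_le_one_left (norm_nonneg _) ht.2).trans hz'
  have hder : ∀ t ∈ Icc (0 : ℝ) 1, HasDerivAt ψ ((gradv u (x + t • (z - x))
      - cxV c (x + t • (z - x)) (Tmap Y u x)) ⬝ᵥ (z - x)) t := by
    intro t ht
    obtain ⟨L, hL, hLv⟩ := h.hasStrictFDerivAt_sub
      (subset_closure (hUΩ (hball (hmem t ht)).2)) (Tmap Y u x)
    rw [← hLv]
    have h1 : HasDerivAt (fun t : ℝ => x + t • (z - x)) (z - x) t := by
      simpa using ((hasDerivAt_id t).smul_const (z - x)).const_add x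
    exact hL.hasFDerivAt.comp_hasDerivAt t h1
  have hmono : StrictMonoOn ψ (Icc 0 1) := by
    refine strictMonoOn_of_deriv_pos (convex_Icc 0 1)
      (fun t ht => (hder t ht).continuousAt.continuousWithinAt) fun t ht => ?_
    rw [interior_Icc] at ht
    have ht' := Ioo_subset_Icc_self ht
    rw [(hder t ht').deriv]
    have h1 := (hball (hmem t ht')).1 (by simpa [ht.1.ne', sub_eq_zero] using hzx)
    rw [add_sub_cancel_left, dotProduct_smul, smul_eq_mul] at h1
    exact pos_of_mul_pos_right h1 ht.1.le
  have h01 := hmono (left_mem_Icc.2 zero_le_one) (right_mem_Icc.2 zero_le_one) zero_lt_one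
  simp only [ψ, zero_smul, add_zero, one_smul, add_sub_cancel] at h01
  simp only [penalized, depthPenalty_eq_zero hs₀ hy]
  linarith [depthPenalty_nonneg s₀ (δ (Tmap Y u z))]

theorem exists_penalized_lt (h : EllipticData c Y Ω Ω' O u) {x y : Fin n → ℝ} {C η : ℝ}
    (hC : 0 ≤ C) (hQ : C < ‖cyV c x y‖) (hη : 0 < η) :
    ∃ y', dist y' y < η ∧ penalized c Y u δ s₀ x y' < penalized c Y u δ s₀ x y - C * dist y' y := by
  obtain ⟨a, hCa, haQ⟩ := exists_between hQ
  obtain ⟨i, hi⟩ : ∃ i, a < |cyV c x y i| := by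
    by_contra! hn
    exact haQ.not_ge ((pi_norm_le_iff_of_nonneg (hC.trans hCa.le)).2 hn)
  obtain ⟨σ, hσ, hσi⟩ : ∃ σ : ℝ, |σ| = 1 ∧ σ * cyV c x y i = |cyV c x y i| := by
    rcases abs_cases (cyV c x y i) with h1 | h1
    · exact ⟨1, by simp, by simp [h1]⟩
    · exact ⟨-1, by simp, by simp [h1]⟩
  have h1 : ContDiff ℝ 2 fun z => c x z :=
    h.contDiff_cost.comp (g := fun q : (Fin n → ℝ) × (Fin n → ℝ) => c q.1 q.2)
      (contDiff_const.prodMk contDiff_id)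
  have h2 := (h1.contDiffAt (x := y)).hasStrictFDerivAt two_ne_zero
  have h3 : (-fderiv ℝ (fun z => c x z) y) (σ • Pi.single i 1) < -a := by
    rw [neg_apply, map_smul, smul_eq_mul]
    change -(σ * cyV c x y i) < -a
    rw [hσi]
    linarith
  have h4 : ∀ᶠ t in 𝓝 (0 : ℝ), 0 ≤ t → -c x (y + t • σ • Pi.single i 1) ≤ -c x y - a * t := by
    have : Tendsto (fun t : ℝ => (y, t)) (𝓝 0) (𝓝 (y, 0)) :=
      (Continuous.prodMk_right y).tendsto 0
    exact this.eventually (h2.neg.eventually_add_smul_le h3)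
  obtain ⟨t, ⟨ht, htη⟩, ht0⟩ := ((h4.and (gt_mem_nhds hη)).filter_mono
    (nhdsWithin_le_nhds (s := Ioi 0))).and self_mem_nhdsWithin |>.exists
  have hdist : dist (y + t • σ • (Pi.single i 1 : Fin n → ℝ)) y = t := by
    rw [dist_eq_norm, add_sub_cancel_left, norm_smul, norm_smul, Pi.norm_single, norm_one,
      Real.norm_eq_abs, Real.norm_eq_abs, hσ, abs_of_pos ht0, mul_one, mul_one]
  refine ⟨_, hdist.trans_lt htη, ?_⟩
  rw [hdist]
  have h5 := ht (le_of_lt ht0)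
  have h6 : C * t < a * t := mul_lt_mul_of_pos_right hCa ht0
  unfold penalized
  linarith

theorem exists_isCompact_penalized (h : EllipticData c Y Ω Ω' O u) (hδ : Continuous δ)
    (hδpos : ∀ y, 0 < δ y ↔ y ∈ Ω') (hs₀ : 0 < s₀) (R a : ℝ) (y : Fin n → ℝ) :
    ∃ K, IsCompact K ∧ K ⊆ Ω ∩ closedBall 0 R ∧
      ∀ x ∈ Ω, ‖x‖ ≤ R → penalized c Y u δ s₀ x y ≤ a → x ∈ K := by
  set B := closure Ω ∩ closedBall 0 R
  have hB : IsCompact B := (isCompact_closedBall 0 R).inter_left isClosed_closure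
  have hBO : B ⊆ O := inter_subset_left.trans h.closure_subset
  obtain ⟨M, hM⟩ := hB.exists_bound_of_continuousOn (f := fun x => u x - c x y)
    (h.continuousOn_sub.comp (continuousOn_id.prodMk continuousOn_const) fun x hx =>
      ⟨hBO hx, mem_univ _⟩)
  set b := (max 0 (a + M) + s₀⁻¹)⁻¹
  have hb : 0 < b := by positivity
  have hcont : ContinuousOn (fun x => δ (Tmap Y u x)) B :=
    hδ.comp_continuousOn (h.continuousOn_Tmap.mono hBO)
  refine ⟨B ∩ (fun x => δ (Tmap Y u x)) ⁻¹' Ici b, ?_, ?_, ?_⟩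
  · exact hB.of_isClosed_subset (hcont.preimage_isClosed_of_isClosed hB.isClosed isClosed_Ici)
      inter_subset_left
  · rintro x ⟨hxB, hx⟩
    exact ⟨(h.Tmap_mem_iff hxB.1).1 ((hδpos _).1 (hb.trans_le hx)), hxB.2⟩
  · intro x hx hxR hxa
    have hxB : x ∈ B := ⟨subset_closure hx, by simpa using hxR⟩
    refine ⟨hxB, inv_le_of_depthPenalty_le ((hδpos _).2 (h.Tmap_mem hx))
      (le_max_of_le_right ?_)⟩
    have h1 := (abs_le.1 (hM x hxB)).1
    unfold penalized at hxa
    linarith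

end EllipticData

namespace EllipticData

variable {c : (Fin n → ℝ) → (Fin n → ℝ) → ℝ} {Y : (Fin n → ℝ) → (Fin n → ℝ) → (Fin n → ℝ)}
  {Ω Ω' O : Set (Fin n → ℝ)} {u : (Fin n → ℝ) → ℝ}

theorem sub_le_sub (h : EllipticData c Y Ω Ω' O u) {x₀ x : Fin n → ℝ} (hx₀ : x₀ ∈ Ω)
    (hx : x ∈ Ω) : u x₀ - c x₀ (Tmap Y u x₀) ≤ u x - c x (Tmap Y u x₀) := by
  rcases eq_or_ne n 0 with rfl | hn
  · rw [Subsingleton.elim x₀ x]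
  have : NeZero n := ⟨hn⟩
  have : Nontrivial (Fin n → ℝ) := Function.nontrivial
  set Γ := Y x '' segment ℝ (cxV c x (Tmap Y u x)) (cxV c x (Tmap Y u x₀)) with hΓdef
  have hYx : Continuous (Y x) :=
    (h.condA1.continuous_uncurry h.contDiff_cost).comp (Continuous.prodMk_right x)
  have hseg : IsCompact (segment ℝ (cxV c x (Tmap Y u x)) (cxV c x (Tmap Y u x₀))) := by
    rw [segment_eq_image_lineMap]
    exact isCompact_Icc.image AffineMap.lineMap_continuous
  have hΓc : IsCompact Γ := hseg.image hYx
  have hΓp : IsPreconnected Γ :=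
    (convex_segment _ _).isPreconnected.image _ hYx.continuousOn
  have hΓΩ : Γ ⊆ Ω' := by
    rintro _ ⟨p, hp, rfl⟩
    obtain ⟨y, hy, rfl⟩ := (h.convex_image x hx).segment_subset
      (mem_image_of_mem _ (h.Tmap_mem hx)) (mem_image_of_mem _ (h.Tmap_mem hx₀)) hp
    simpa [h.condA1.Y_cxV] using hy
  have hy₀ : Tmap Y u x ∈ Γ := ⟨_, left_mem_segment ℝ _ _, h.condA1.Y_cxV _ _⟩
  have hy₁ : Tmap Y u x₀ ∈ Γ := ⟨_, right_mem_segment ℝ _ _, h.condA1.Y_cxV _ _⟩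
  obtain ⟨r, hr, hrΩ⟩ := hΓc.exists_cthickening_subset_open h.isOpen_target hΓΩ
  set Z := cthickening r Γ
  have hZ : IsCompact Z := hΓc.cthickening
  have hΓZ : Γ ⊆ Z := self_subset_cthickening Γ
  obtain ⟨X, hXc, hXΩ, hTX, hXT⟩ := h.exists_inverse
  obtain ⟨δ, hδ, hδ0, hδpos, hmono⟩ := exists_depth h.isOpen_target
  have hcont := h.continuousOn_sub
  obtain ⟨R₁, hR₁⟩ := hZ.exists_bound_of_continuousOn (hXc.mono hrΩ)
  obtain ⟨D, hD⟩ := hΓc.exists_bound_of_continuousOn (f := fun y => u x - c x y)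
    (hcont.comp (continuousOn_const.prodMk continuousOn_id) fun y _ =>
      ⟨h.closure_subset (subset_closure hx), mem_univ _⟩)
  obtain ⟨m, hm⟩ := hZ.exists_bound_of_continuousOn (f := fun y => u (X y) - c (X y) y)
    (hcont.comp ((hXc.mono hrΩ).prodMk continuousOn_id) fun y hy =>
      ⟨h.closure_subset (subset_closure (hXΩ y (hrΩ hy))), mem_univ _⟩)
  set C := max 0 (2 * (D + m) / r) + 1
  have hC0 : 0 ≤ C := by positivity
  obtain ⟨R₂, hR₂⟩ := h.condA1.exists_norm_lt h.contDiff_cost hZ C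
  set R := max R₁ (max R₂ (max ‖x‖ ‖x₀‖))
  have hRU : ∀ z : Fin n → ℝ, ‖z‖ ≤ R → z ∈ ball 0 (R + 1) := fun z hz => by
    rw [mem_ball_zero_iff]; linarith
  have hXR : ∀ y ∈ Z, X y ∈ Ω ∩ ball 0 (R + 1) := fun y hy =>
    ⟨hXΩ y (hrΩ hy), hRU _ ((hR₁ y hy).trans (le_max_left _ _))⟩
  have hxR : x ∈ Ω ∩ ball 0 (R + 1) := ⟨hx, hRU _ (by simp [R])⟩
  have hU : IsOpen (Ω ∩ ball (0 : Fin n → ℝ) (R + 1)) := h.isOpen_source.inter isOpen_ball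
  obtain ⟨s, hs, hgrow⟩ := h.exists_forall_depthGrows hδ hδ0 hδpos hmono
    ((isCompact_closedBall (0 : Fin n → ℝ) (R + 1)).inter_left isClosed_closure)
    inter_subset_left hZ hrΩ
  obtain ⟨s₁, hs₁, hδZ⟩ := hZ.exists_forall_le' (a := 0) hδ.continuousOn
    fun y hy => (hδpos y).2 (hrΩ hy)
  set s₀ := min (s / 2) s₁
  have hs₀ : 0 < s₀ := lt_min (half_pos hs) hs₁
  have hs₀s : s₀ < s := (min_le_left _ _).trans_lt (half_lt_self hs)
  have hs₀Z : ∀ y ∈ Z, s₀ ≤ δ y := fun y hy => (min_le_right _ _).trans (hδZ y hy)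
  have hval : ∀ z, Tmap Y u z ∈ Z → ∀ y, penalized c Y u δ s₀ z y = u z - c z y :=
    fun z hz y => by rw [penalized, depthPenalty_eq_zero hs₀ (hs₀Z _ hz), add_zero]
  have hf : ContinuousOn (Function.uncurry (penalized c Y u δ s₀))
      ((Ω ∩ ball 0 (R + 1)) ×ˢ univ) :=
    (h.continuousOn_penalized hδ hδpos).mono (prod_mono_left inter_subset_left)
  have hdesc : ∀ y ∈ Z, ∀ z ∈ Ω ∩ ball 0 (R + 1), z ≠ X y →
      HasDescent (penalized c Y u δ s₀) z y := by
    intro y hy z hz hne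
    refine h.hasDescent_penalized hδ hδpos hs₀ hz.1 (fun hT => hne ?_) ?_
    · rw [← hT, hXT z hz.1]
    · refine (lt_or_ge s₀ _).imp_right fun hle => ?_
      exact hgrow z ⟨subset_closure hz.1, ball_subset_closedBall hz.2⟩ y hy (hle.trans_lt hs₀s)
  have hbar : HasBarrier (penalized c Y u δ s₀) (Ω ∩ ball 0 (R + 1)) x (Tmap Y u x₀) := by
    refine HasBarrier.of_isPreconnected (X := X) (m := m) (R := R) (C := C) (D := D) hU hf hr
      (fun y hy => closedBall_subset_cthickening hy r) hΓp hdesc ?_ ?_ ?_ ?_ ?_ hy₀ ?_ ?_ hy₁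
    · exact fun y hy => h.hasBarrier_penalized hU inter_subset_left hs₀ (hXR y hy)
        (hTX y (hrΩ hy)) (hs₀Z y hy)
    · intro y hy
      rw [hval _ ((hTX y (hrΩ hy)).symm ▸ hy)]
      exact (abs_le.1 (hm y hy)).1
    · exact (le_max_right _ _).trans_lt (lt_add_one _)
    · intro z _ hz y hy η hη
      refine h.exists_penalized_lt hC0 (not_le.1 fun hQ => ?_) hη
      have := hR₂ y hy z hQ
      exact this.not_ge (((le_max_left _ _).trans (le_max_right _ _)).trans hz)
    · intro y _ a
      obtain ⟨K, hK, hKΩ, hKa⟩ := h.exists_isCompact_penalized hδ hδpos hs₀ R a y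
      refine ⟨K, hK, hKΩ.trans (inter_subset_inter_right _ fun z hz => ?_),
        fun z hz => hKa z hz.1⟩
      exact hRU z (by simpa using hz)
    · exact h.hasBarrier_penalized hU inter_subset_left hs₀ hxR rfl (hs₀Z _ (hΓZ hy₀))
    · intro y hy
      rw [hval x (hΓZ hy₀)]
      exact (abs_le.1 (hD y hy)).2
  obtain ⟨K, hK⟩ := hbar
  have hle := (hK.mem_interior_of_forall_hasDescent (x₀ := x₀) hf fun z hz hne =>
    hdesc _ (hΓZ hy₁) z hz (by rwa [hXT x₀ hx₀])).2
  rwa [hval x₀ (hΓZ hy₁), hval x (hΓZ hy₀)] at hle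

end EllipticData

end

/-- If `Ω*` is c*-convex with respect to `Ω`, any elliptic solution of the
second boundary value problem whose mapping `Tu` is one-to-one is globally
c-convex. -/
theorem elliptic_solution_globally_c_convex
    {n : ℕ} (c : (Fin n → ℝ) → (Fin n → ℝ) → ℝ)
    (Y : (Fin n → ℝ) → (Fin n → ℝ) → (Fin n → ℝ))
    (Ω Ω' : Set (Fin n → ℝ))
    (ψ : (Fin n → ℝ) → ℝ → (Fin n → ℝ) → ℝ) (u : (Fin n → ℝ) → ℝ)
    (hc : ContDiff ℝ 2 (fun q : (Fin n → ℝ) × (Fin n → ℝ) => c q.1 q.2))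
    (hΩo : IsOpen Ω) (hΩ'o : IsOpen Ω')
    -- conditions A1, A2
    (hA1 : CondA1 c Y) (hA2 : CondA2 c Ω Ω')
    -- Ω* is c*-convex with respect to Ω
    (hcsconv : ∀ x ∈ Ω, Convex ℝ ((fun y => cxV c x y) '' Ω'))
    -- u ∈ C²(Ω̄) is an elliptic solution of the second boundary value problem
    (hu : CkOnClosure 2 u Ω)
    (hell : Elliptic c Y u Ω)
    (heq : MAeq c Y u ψ Ω)
    (hbv : Tmap Y u '' Ω = Ω')
    -- Tu is one-to-one on Ω̄
    (hinj : Set.InjOn (Tmap Y u) (closure Ω)) :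
    ∀ x₀ ∈ Ω, ∀ x ∈ Ω,
      u x ≥ u x₀ + c x (Tmap Y u x₀) - c x₀ (Tmap Y u x₀) := by
  obtain ⟨O, hO, hsub, huO⟩ := hu
  have h : EllipticData c Y Ω Ω' O u :=
    ⟨hc, hΩo, hΩ'o, hA1, hA2, hcsconv, hO, hsub, huO, hell, hbv, hinj⟩
  intro x₀ hx₀ x hx
  linarith [h.sub_le_sub hx₀ hx]
end
end

section
/- For the cost function c(x,y) = −√(1+|x−y|²) on ℝⁿ×ℝⁿ: (i) for |p| < 1, the unique solution y of c_x(x,y) = p is Y(x,p) = x + p/√(1−|p|²), and the matrix A(x,p) = c_{xx}(x,Y(x,p)) equals A(p) = −(1−|p|²)^{1/2}(I − p⊗p); (ii) c satisfies condition (A3) on this range: for every 0 < r < 1 there is δ > 0 such that Σ D_{p_kp_l}A_{ij}(p) ξ_iξ_jη_kη_l ≥ δ|ξ|²|η|² for all |p| ≤ r and all ξ, η ∈ ℝⁿ with ξ ⊥ η. -/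
noncomputable section

variable {n : ℕ}

/-- Example 1: the cost function `c(x,y) = −√(1+|x−y|²)`. -/
def c16 : (Fin n → ℝ) → (Fin n → ℝ) → ℝ :=
  fun x y => -Real.sqrt (1 + ∑ i, (x i - y i) ^ 2)

/-- The corresponding map `Y(x,p) = x + p/√(1−|p|²)`. -/
def Y16 : (Fin n → ℝ) → (Fin n → ℝ) → (Fin n → ℝ) :=
  fun x p => x + (Real.sqrt (1 - ∑ i, p i ^ 2))⁻¹ • p

/-- Partial derivatives depend only on the germ of the function. -/
lemma pd_congr {f g : (Fin n → ℝ) → ℝ} {x : Fin n → ℝ} (i : Fin n)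
    (h : f =ᶠ[nhds x] g) : pd i f x = pd i g x := by
  simp only [pd, h.fderiv_eq]

lemma pd_mul {f g : (Fin n → ℝ) → ℝ} {x : Fin n → ℝ} (i : Fin n)
    (hf : DifferentiableAt ℝ f x) (hg : DifferentiableAt ℝ g x) :
    pd i (fun z => f z * g z) x = f x * pd i g x + g x * pd i f x := by
  simp [pd, fderiv_fun_mul hf hg]

lemma pd_add {f g : (Fin n → ℝ) → ℝ} {x : Fin n → ℝ} (i : Fin n)
    (hf : DifferentiableAt ℝ f x) (hg : DifferentiableAt ℝ g x) :
    pd i (fun z => f z + g z) x = pd i f x + pd i g x := by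
  simp [pd, fderiv_fun_add hf hg]

lemma pd_comp {g : ℝ → ℝ} {g' : ℝ} {f : (Fin n → ℝ) → ℝ} {x : Fin n → ℝ} (i : Fin n)
    (hg : HasDerivAt g g' (f x)) (hf : DifferentiableAt ℝ f x) :
    pd i (fun z => g (f z)) x = g' * pd i f x := by
  have h := (hg.comp_hasFDerivAt x hf.hasFDerivAt).fderiv
  simp only [pd]
  rw [show (fun z => g (f z)) = g ∘ f from rfl, h]
  simp

lemma pd_const_sub_coord_mul_coord (a : ℝ) (i j l : Fin n) (x : Fin n → ℝ) :
    pd l (fun z => a - z i * z j) x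
      = -((if i = l then (1 : ℝ) else 0) * x j + x i * (if j = l then (1 : ℝ) else 0)) := by
  have h := ((hasFDerivAt_apply (𝕜 := ℝ) i x).mul (hasFDerivAt_apply (𝕜 := ℝ) j x)).const_sub a
  simp only [pd]
  have h' : fderiv ℝ (fun z : Fin n → ℝ => a - z i * z j) x = _ := h.fderiv
  rw [h']
  simp [Pi.single_apply]
  ring

lemma pd_coord_sub_const (a : ℝ) (i l : Fin n) (x : Fin n → ℝ) :
    pd l (fun z => z i - a) x = if i = l then (1 : ℝ) else 0 := by
  have h := (hasFDerivAt_apply (𝕜 := ℝ) i x).sub_const a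
  simp only [pd]
  rw [h.fderiv]
  simp [Pi.single_apply]

lemma pd_coord (i l : Fin n) (x : Fin n → ℝ) :
    pd l (fun z => z i) x = if i = l then (1 : ℝ) else 0 := by
  simpa using pd_coord_sub_const 0 i l x

lemma pd_sum_sq_sub (y : Fin n → ℝ) (l : Fin n) (x : Fin n → ℝ) :
    pd l (fun z => ∑ i, (z i - y i) ^ 2) x = 2 * (x l - y l) := by
  have h := HasFDerivAt.fun_sum (u := Finset.univ)
    (fun i _ => ((hasFDerivAt_apply (𝕜 := ℝ) i x).sub_const (y i)).pow 2)
  simp only [pd]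
  rw [h.fderiv]
  simp [Pi.single_apply]

lemma pd_sum_sq (l : Fin n) (x : Fin n → ℝ) :
    pd l (fun z => ∑ i, z i ^ 2) x = 2 * x l := by
  simpa using pd_sum_sq_sub 0 l x

lemma one_add_sum_sq_pos (x y : Fin n → ℝ) : 0 < 1 + ∑ i, (x i - y i) ^ 2 := by
  have := Finset.sum_nonneg (fun i (_ : i ∈ Finset.univ) => sq_nonneg (x i - y i))
  linarith

lemma hasDerivAt_sqrt_const_add {a t : ℝ} (h : 0 < a + t) :
    HasDerivAt (fun s => √(a + s)) (1 / (2 * √(a + t))) t :=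
  ((hasDerivAt_id t).const_add a).sqrt h.ne'

lemma hasDerivAt_sqrt_const_sub {a t : ℝ} (h : 0 < a - t) :
    HasDerivAt (fun s => √(a - s)) (-1 / (2 * √(a - t))) t :=
  ((hasDerivAt_id t).const_sub a).sqrt h.ne'

lemma pd_c16 (y x : Fin n → ℝ) (j : Fin n) :
    pd j (fun z => c16 z y) x = (x j - y j) * -(√(1 + ∑ i, (x i - y i) ^ 2))⁻¹ := by
  have h := one_add_sum_sq_pos x y
  have hs := Real.sqrt_pos.2 h
  simp only [c16]
  rw [pd_comp (g := fun t => -√(1 + t)) (f := fun z : Fin n → ℝ => ∑ i, (z i - y i) ^ 2) j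
    (hasDerivAt_sqrt_const_add h).neg (by fun_prop), pd_sum_sq_sub]
  field_simp

lemma cxxM_c16 (x y : Fin n → ℝ) (i j : Fin n) :
    cxxM c16 x y i j = -(√(1 + ∑ k, (x k - y k) ^ 2))⁻¹ * ((if i = j then (1 : ℝ) else 0)
      - (x i - y i) * (x j - y j) * ((√(1 + ∑ k, (x k - y k) ^ 2))⁻¹) ^ 2) := by
  have h := one_add_sum_sq_pos x y
  have hs := Real.sqrt_pos.2 h
  have hd := ((hasDerivAt_sqrt_const_add h).fun_inv hs.ne').fun_neg
  have hq : DifferentiableAt ℝ (fun z : Fin n → ℝ => ∑ k, (z k - y k) ^ 2) x := by fun_prop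
  simp only [cxxM, hessM, Matrix.of_apply, pd_c16]
  have hI : DifferentiableAt ℝ (fun z : Fin n → ℝ => -(√(1 + ∑ k, (z k - y k) ^ 2))⁻¹) x :=
    hd.differentiableAt.comp (f := fun z : Fin n → ℝ => ∑ k, (z k - y k) ^ 2) x hq
  rw [pd_mul i (by fun_prop) hI,
    pd_comp (f := fun z : Fin n → ℝ => ∑ k, (z k - y k) ^ 2) i hd hq, pd_sum_sq_sub,
    pd_coord_sub_const]
  simp only [eq_comm (a := j)]
  field_simp
  ring

lemma one_sub_sum_sq_div_sqrt (d : Fin n → ℝ) :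
    1 - ∑ i, (d i * (√(1 + ∑ k, d k ^ 2))⁻¹) ^ 2 = ((√(1 + ∑ k, d k ^ 2))⁻¹) ^ 2 := by
  have h : 0 < 1 + ∑ i, d i ^ 2 := by simpa using one_add_sum_sq_pos d 0
  simp only [mul_pow, ← Finset.sum_mul]
  rw [inv_pow, Real.sq_sqrt h.le]
  field_simp
  ring

lemma sqrt_one_add_sum_sq_Y16 (x p : Fin n → ℝ) (hp : ∑ i, p i ^ 2 < 1) :
    (√(1 + ∑ k, (x k - Y16 x p k) ^ 2))⁻¹ = √(1 - ∑ k, p k ^ 2) := by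
  have h : 0 < 1 - ∑ i, p i ^ 2 := by linarith
  have hsum : 1 + ∑ k, (x k - Y16 x p k) ^ 2 = (1 - ∑ k, p k ^ 2)⁻¹ := by
    have : ∀ k, (x k - Y16 x p k) ^ 2 = (1 - ∑ k, p k ^ 2)⁻¹ * p k ^ 2 := fun k => by
      simp [Y16, mul_pow, Real.sq_sqrt h.le]
    simp only [this, ← Finset.mul_sum]
    field_simp
    ring
  rw [hsum, Real.sqrt_inv, inv_inv]

lemma cxV_c16_Y16 (x p : Fin n → ℝ) (hp : ∑ i, p i ^ 2 < 1) :
    cxV c16 x (Y16 x p) = p := by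
  have hs : 0 < √(1 - ∑ i, p i ^ 2) := Real.sqrt_pos.2 (by linarith)
  funext j
  simp only [cxV, gradv, pd_c16]
  rw [sqrt_one_add_sum_sq_Y16 x p hp]
  simp only [Y16, Pi.add_apply, Pi.smul_apply, smul_eq_mul]
  field_simp
  ring

lemma Y16_cxV_c16 (x y : Fin n → ℝ) : Y16 x (cxV c16 x y) = y := by
  have hs := Real.sqrt_pos.2 (one_add_sum_sq_pos x y)
  have h := one_sub_sum_sq_div_sqrt (fun i => x i - y i)
  funext j
  simp only [cxV, gradv, Y16, Pi.add_apply, Pi.smul_apply, smul_eq_mul, pd_c16, mul_neg, neg_sq]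
  rw [h, Real.sqrt_sq (by positivity)]
  field_simp
  ring

lemma cxxM_c16_Y16 (x p : Fin n → ℝ) (hp : ∑ i, p i ^ 2 < 1) (i j : Fin n) :
    cxxM c16 x (Y16 x p) i j =
      -√(1 - ∑ k, p k ^ 2) * ((if i = j then (1 : ℝ) else 0) - p i * p j) := by
  have hs : 0 < √(1 - ∑ i, p i ^ 2) := Real.sqrt_pos.2 (by linarith)
  rw [cxxM_c16, sqrt_one_add_sum_sq_Y16 x p hp]
  simp only [Y16, Pi.add_apply, Pi.smul_apply, smul_eq_mul]
  field_simp
  ring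

lemma isOpen_setOf_sum_sq_lt_one : IsOpen {p : Fin n → ℝ | ∑ i, p i ^ 2 < 1} :=
  isOpen_lt (by fun_prop) continuous_const

lemma pd_AMat_c16 (x p : Fin n → ℝ) (hp : ∑ i, p i ^ 2 < 1) (i j l : Fin n) :
    pd l (fun r => AMat c16 Y16 x r i j) p =
      p l * (√(1 - ∑ k, p k ^ 2))⁻¹ * ((if i = j then (1 : ℝ) else 0) - p i * p j)
      + √(1 - ∑ k, p k ^ 2) *
        ((if i = l then (1 : ℝ) else 0) * p j + p i * (if j = l then (1 : ℝ) else 0)) := by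
  have h : 0 < 1 - ∑ i, p i ^ 2 := by linarith
  have hs := Real.sqrt_pos.2 h
  have hd := (hasDerivAt_sqrt_const_sub h).fun_neg
  have hq : DifferentiableAt ℝ (fun z : Fin n → ℝ => ∑ k, z k ^ 2) p := by fun_prop
  have he : (fun r => AMat c16 Y16 x r i j) =ᶠ[nhds p] fun r =>
      -√(1 - ∑ k, r k ^ 2) * ((if i = j then (1 : ℝ) else 0) - r i * r j) := by
    filter_upwards [isOpen_setOf_sum_sq_lt_one.mem_nhds hp] with r hr
    exact cxxM_c16_Y16 x r hr i j
  have hS : DifferentiableAt ℝ (fun z : Fin n → ℝ => -√(1 - ∑ k, z k ^ 2)) p :=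
    hd.differentiableAt.comp (f := fun z : Fin n → ℝ => ∑ k, z k ^ 2) p hq
  rw [pd_congr l he, pd_mul l hS (by fun_prop),
    pd_comp (f := fun z : Fin n → ℝ => ∑ k, z k ^ 2) l hd hq, pd_sum_sq,
    pd_const_sub_coord_mul_coord]
  field_simp
  ring

lemma D2pA_c16 (x p : Fin n → ℝ) (hp : ∑ i, p i ^ 2 < 1) (i j k l : Fin n) :
    D2pA c16 Y16 i j k l x p =
      ((if i = j then (1 : ℝ) else 0) - p i * p j) *
        ((if k = l then (1 : ℝ) else 0) * (√(1 - ∑ k, p k ^ 2))⁻¹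
          + p k * p l * (√(1 - ∑ k, p k ^ 2))⁻¹ ^ 3)
      - (√(1 - ∑ k, p k ^ 2))⁻¹ *
        ((if i = k then (1 : ℝ) else 0) * (p j * p l)
          + (if j = k then (1 : ℝ) else 0) * (p i * p l)
          + (if i = l then (1 : ℝ) else 0) * (p j * p k)
          + (if j = l then (1 : ℝ) else 0) * (p i * p k))
      + √(1 - ∑ k, p k ^ 2) *
        ((if i = l then (1 : ℝ) else 0) * (if j = k then (1 : ℝ) else 0)
          + (if i = k then (1 : ℝ) else 0) * (if j = l then (1 : ℝ) else 0)) := by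
  have h : 0 < 1 - ∑ i, p i ^ 2 := by linarith
  have hs := Real.sqrt_pos.2 h
  have hd := hasDerivAt_sqrt_const_sub h
  have hd' := hd.fun_inv hs.ne'
  have hq : DifferentiableAt ℝ (fun z : Fin n → ℝ => ∑ k, z k ^ 2) p := by fun_prop
  have hS : DifferentiableAt ℝ (fun z : Fin n → ℝ => √(1 - ∑ k, z k ^ 2)) p :=
    hd.differentiableAt.comp (f := fun z : Fin n → ℝ => ∑ k, z k ^ 2) p hq
  have hI : DifferentiableAt ℝ (fun z : Fin n → ℝ => (√(1 - ∑ k, z k ^ 2))⁻¹) p :=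
    hd'.differentiableAt.comp (f := fun z : Fin n → ℝ => ∑ k, z k ^ 2) p hq
  have hpS := pd_comp (f := fun z : Fin n → ℝ => ∑ k, z k ^ 2) k hd hq
  have hpI : pd k (fun z : Fin n → ℝ => (√(1 - ∑ k, z k ^ 2))⁻¹) p = _ :=
    pd_comp (f := fun z : Fin n → ℝ => ∑ k, z k ^ 2) k hd' hq
  have hL : pd k (fun q : Fin n → ℝ =>
      (if i = l then (1 : ℝ) else 0) * q j + q i * (if j = l then (1 : ℝ) else 0)) p
      = (if i = l then (1 : ℝ) else 0) * (if j = k then (1 : ℝ) else 0)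
        + (if i = k then (1 : ℝ) else 0) * (if j = l then (1 : ℝ) else 0) := by
    have hc (a : ℝ) : pd k (fun _ => a) p = 0 := by simp [pd]
    rw [pd_add k (by fun_prop) (by fun_prop), pd_mul k (by fun_prop) (by fun_prop),
      pd_mul k (by fun_prop) (by fun_prop), pd_coord, pd_coord, hc, hc]
    ring
  have he : (fun q => pd l (fun r => AMat c16 Y16 x r i j) q) =ᶠ[nhds p] fun q =>
      q l * (√(1 - ∑ k, q k ^ 2))⁻¹ * ((if i = j then (1 : ℝ) else 0) - q i * q j)
      + √(1 - ∑ k, q k ^ 2) *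
        ((if i = l then (1 : ℝ) else 0) * q j + q i * (if j = l then (1 : ℝ) else 0)) := by
    filter_upwards [isOpen_setOf_sum_sq_lt_one.mem_nhds hp] with q hq
    exact pd_AMat_c16 x q hq i j l
  have hl : DifferentiableAt ℝ (fun z : Fin n → ℝ => z l) p := by fun_prop
  rw [D2pA, pd_congr k he,
    pd_add k ((hl.fun_mul hI).fun_mul (by fun_prop)) (hS.fun_mul (by fun_prop)),
    pd_mul k (hl.fun_mul hI) (by fun_prop), pd_mul k hl hI, pd_mul k hS (by fun_prop), hL, hpS, hpI,
    pd_sum_sq, pd_const_sub_coord_mul_coord, pd_coord]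
  simp only [eq_comm (a := l) (b := k)]
  field_simp
  ring

lemma sum_sum_sum_sum_mul (F G : Fin n → Fin n → ℝ) :
    ∑ i, ∑ j, ∑ k, ∑ l, F i j * G k l = (∑ i, ∑ j, F i j) * ∑ k, ∑ l, G k l := by
  simp only [← Finset.mul_sum, ← Finset.sum_mul]

lemma sum_sum_sum_sum_mul_swap (F G : Fin n → Fin n → ℝ) :
    ∑ i, ∑ j, ∑ k, ∑ l, F i k * G j l = (∑ i, ∑ k, F i k) * ∑ j, ∑ l, G j l := by
  rw [← sum_sum_sum_sum_mul]
  exact Finset.sum_congr rfl fun i _ => Finset.sum_comm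

lemma sum_sum_sum_sum_mul_cross (F G : Fin n → Fin n → ℝ) :
    ∑ i, ∑ j, ∑ k, ∑ l, F i l * G j k = (∑ i, ∑ l, F i l) * ∑ j, ∑ k, G j k := by
  rw [← sum_sum_sum_sum_mul_swap]
  exact Finset.sum_congr rfl fun i _ => Finset.sum_congr rfl fun j _ => Finset.sum_comm

/-- The quartic form of `D_{pp} A` on orthogonal pairs of vectors. -/
lemma sum_D2pA_c16 (x p ξ η : Fin n → ℝ) (hp : ∑ i, p i ^ 2 < 1) (hξη : ∑ i, ξ i * η i = 0) :
    ∑ i, ∑ j, ∑ k, ∑ l, D2pA c16 Y16 i j k l x p * ξ i * ξ j * η k * η l =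
      (∑ i, ξ i ^ 2 - (∑ i, p i * ξ i) ^ 2) *
        ((∑ i, η i ^ 2) * (√(1 - ∑ k, p k ^ 2))⁻¹
          + (∑ i, p i * η i) ^ 2 * (√(1 - ∑ k, p k ^ 2))⁻¹ ^ 3) := by
  set s := √(1 - ∑ k, p k ^ 2) with hs
  let F : Fin n → Fin n → ℝ := fun i j =>
    (if i = j then (1 : ℝ) else 0) * (ξ i * ξ j) - (p i * ξ i) * (p j * ξ j)
  let G : Fin n → Fin n → ℝ := fun k l =>
    (if k = l then (1 : ℝ) else 0) * (η k * η l) * s⁻¹ + (p k * η k) * (p l * η l) * s⁻¹ ^ 3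
  let D : Fin n → Fin n → ℝ := fun i k => (if i = k then (1 : ℝ) else 0) * (ξ i * η k)
  let U : Fin n → Fin n → ℝ := fun j l => -s⁻¹ * ((p j * ξ j) * (p l * η l))
  let V : Fin n → Fin n → ℝ := fun j l => U j l + s * D j l
  have hD : ∑ i, ∑ k, D i k = 0 := by simpa [D] using hξη
  have hF : ∑ i, ∑ j, F i j = ∑ i, ξ i ^ 2 - (∑ i, p i * ξ i) ^ 2 := by
    simp [F, Finset.sum_sub_distrib, ← Finset.mul_sum, ← Finset.sum_mul, sq]
  have hG : ∑ k, ∑ l, G k l = (∑ i, η i ^ 2) * s⁻¹ + (∑ i, p i * η i) ^ 2 * s⁻¹ ^ 3 := by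
    simp [G, Finset.sum_add_distrib, ← Finset.mul_sum, ← Finset.sum_mul, sq]
  have key : ∀ i j k l, D2pA c16 Y16 i j k l x p * ξ i * ξ j * η k * η l =
      F i j * G k l + D i k * V j l + U i k * D j l + D i l * V j k + U i l * D j k :=
    fun i j k l => by
      rw [D2pA_c16 x p hp]
      simp only [F, G, D, U, V]
      ring
  simp only [key, Finset.sum_add_distrib, sum_sum_sum_sum_mul, sum_sum_sum_sum_mul_swap,
    sum_sum_sum_sum_mul_cross, hD, hF, hG]
  ring

/-- **Example 1**: for `c(x,y) = −√(1+|x−y|²)` and `|p| < 1`, the unique solution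
of `c_x(x,y) = p` is `Y(x,p) = x + p/√(1−|p|²)`,
`A(p) = −(1−|p|²)^{1/2}(I − p⊗p)`, and `c` satisfies condition (A3) on this range. -/
theorem example1_cost
    {n : ℕ} :
    -- (i) Y and A are as stated
    (∀ x p : Fin n → ℝ, (∑ i, p i ^ 2) < 1 →
      (cxV c16 x (Y16 x p) = p ∧
        ∀ y : Fin n → ℝ, cxV c16 x y = p → y = Y16 x p) ∧
      (∀ i j, cxxM c16 x (Y16 x p) i j =
        -Real.sqrt (1 - ∑ k, p k ^ 2) * ((if i = j then (1:ℝ) else 0) - p i * p j))) ∧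
    -- (ii) condition (A3) holds for |p| ≤ r < 1
    (∀ r : ℝ, 0 < r → r < 1 →
      ∃ δ > (0:ℝ), ∀ x p : Fin n → ℝ, (∑ i, p i ^ 2) ≤ r ^ 2 →
        ∀ ξ η : Fin n → ℝ, (∑ i, ξ i * η i) = 0 →
          δ * (∑ i, ξ i ^ 2) * (∑ i, η i ^ 2) ≤
            ∑ i, ∑ j, ∑ k, ∑ l,
              D2pA c16 Y16 i j k l x p * ξ i * ξ j * η k * η l) := by
  refine ⟨fun x p hp => ⟨⟨cxV_c16_Y16 x p hp, fun y hy => ?_⟩, cxxM_c16_Y16 x p hp⟩,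
    fun r hr0 hr1 => ⟨1 - r ^ 2, by nlinarith, fun x p hp ξ η hξη => ?_⟩⟩
  · rw [← hy, Y16_cxV_c16]
  · have hp1 : ∑ i, p i ^ 2 < 1 := by nlinarith
    have hs : 0 < √(1 - ∑ k, p k ^ 2) := Real.sqrt_pos.2 (by linarith)
    have hs1 : √(1 - ∑ k, p k ^ 2) ≤ 1 :=
      Real.sqrt_le_one.2 (by
        linarith [Finset.sum_nonneg fun i (_ : i ∈ Finset.univ) => sq_nonneg (p i)])
    have hξ : 0 ≤ ∑ i, ξ i ^ 2 := Finset.sum_nonneg fun i _ => sq_nonneg _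
    have hη : 0 ≤ ∑ i, η i ^ 2 := Finset.sum_nonneg fun i _ => sq_nonneg _
    have hcs : (∑ i, p i * ξ i) ^ 2 ≤ (∑ i, p i ^ 2) * ∑ i, ξ i ^ 2 :=
      Finset.sum_mul_sq_le_sq_mul_sq _ _ _
    rw [sum_D2pA_c16 x p ξ η hp1 hξη]
    have hleft : (1 - r ^ 2) * ∑ i, ξ i ^ 2 ≤ ∑ i, ξ i ^ 2 - (∑ i, p i * ξ i) ^ 2 := by
      nlinarith
    have hright : ∑ i, η i ^ 2 ≤ (∑ i, η i ^ 2) * (√(1 - ∑ k, p k ^ 2))⁻¹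
        + (∑ i, p i * η i) ^ 2 * (√(1 - ∑ k, p k ^ 2))⁻¹ ^ 3 :=
      (le_mul_of_one_le_right hη ((one_le_inv₀ hs).2 hs1)).trans
        (le_add_of_nonneg_right (by positivity))
    have hnonneg : 0 ≤ (1 - r ^ 2) * ∑ i, ξ i ^ 2 := mul_nonneg (by nlinarith) hξ
    exact mul_le_mul hleft hright hη (hnonneg.trans hleft)
end
end
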